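/- arXiv:1512.09047 — 2 statements merged into one kernel-verified Lean document; each statement's English description precedes it below -/
import Mathlib

section
/- Fannes-type continuity bound for QCMI: for finite-dimensional tripartite states ρ, σ on H_ABC with ε = (1/2)·‖ρ − σ‖₁ and d = min{dim H_A, dim H_B}, one has |I(A:B|C)_ρ − I(A:B|C)_σ| ≤ 2ε·log d + 2g(ε), where g(ε) = (1+ε)·log(1+ε) − ε·log ε. -/
set_option maxHeartbeats 1000000

open Matrix Real
open scoped ComplexOrder

noncomputable section

/-- The von Neumann entropy of a (Hermitian) matrix, via its eigenvalues. -/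
def vnEntropy {n : Type*} [Fintype n] [DecidableEq n] (A : Matrix n n ℂ) : ℝ :=
  if h : A.IsHermitian then ∑ i, Real.negMulLog (h.eigenvalues i) else 0

/-- The trace norm of a matrix: the sum of its singular values. -/
def traceNorm {n : Type*} [Fintype n] [DecidableEq n] (A : Matrix n n ℂ) : ℝ :=
  ∑ i, Real.sqrt ((Matrix.posSemidef_conjTranspose_mul_self A).1.eigenvalues i)

/-- A density operator: positive semidefinite with unit trace. -/
def IsState {n : Type*} [Fintype n] (A : Matrix n n ℂ) : Prop := A.PosSemidef ∧ A.trace = 1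

variable {α β γ : Type*} [Fintype α] [DecidableEq α] [Fintype β] [DecidableEq β]
  [Fintype γ] [DecidableEq γ]

/-- The marginal ρ_AC of a tripartite state. -/
def margAC (ρ : Matrix (α × β × γ) (α × β × γ) ℂ) : Matrix (α × γ) (α × γ) ℂ :=
  fun x y => ∑ k : β, ρ (x.1, k, x.2) (y.1, k, y.2)

/-- The marginal ρ_BC of a tripartite state. -/
def margBC (ρ : Matrix (α × β × γ) (α × β × γ) ℂ) : Matrix (β × γ) (β × γ) ℂ :=
  fun x y => ∑ k : α, ρ (k, x.1, x.2) (k, y.1, y.2)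

/-- The marginal ρ_C of a tripartite state. -/
def margC (ρ : Matrix (α × β × γ) (α × β × γ) ℂ) : Matrix γ γ ℂ :=
  fun i j => ∑ k : α, ∑ l : β, ρ (k, l, i) (k, l, j)

/-- The quantum conditional mutual information
I(A:B|C) = H(ρ_AC) + H(ρ_BC) - H(ρ_ABC) - H(ρ_C). -/
def qcmi (ρ : Matrix (α × β × γ) (α × β × γ) ℂ) : ℝ :=
  vnEntropy (margAC ρ) + vnEntropy (margBC ρ) - vnEntropy ρ - vnEntropy (margC ρ)

/-- g(ε) = (1+ε)·log(1+ε) − ε·log ε. -/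
def gFun (x : ℝ) : ℝ := (1 + x) * Real.log (1 + x) - x * Real.log x


/-- A spectral decomposition of a matrix. -/
structure SpecDec {n : Type*} [Fintype n] [DecidableEq n] (A U : Matrix n n ℂ) (p : n → ℝ) :
    Prop where
  left : Uᴴ * U = 1
  right : U * Uᴴ = 1
  eq : A = U * diagonal (fun i => (p i : ℂ)) * Uᴴ

theorem SpecDec.of_hermitian {n : Type*} [Fintype n] [DecidableEq n] {A : Matrix n n ℂ}
    (h : A.IsHermitian) : SpecDec A (h.eigenvectorUnitary : Matrix n n ℂ) h.eigenvalues := by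
  refine ⟨?_, ?_, ?_⟩
  · exact Unitary.coe_star_mul_self h.eigenvectorUnitary
  · exact Unitary.coe_mul_star_self h.eigenvectorUnitary
  · conv_lhs => rw [h.spectral_theorem, Unitary.conjStarAlgAut_apply]
    rfl

theorem SpecDec.hermitian {n : Type*} [Fintype n] [DecidableEq n] {A U : Matrix n n ℂ}
    {p : n → ℝ} (h : SpecDec A U p) : A.IsHermitian := by
  rw [h.eq, Matrix.IsHermitian, conjTranspose_mul, conjTranspose_mul, conjTranspose_conjTranspose,
    diagonal_conjTranspose, ← mul_assoc]
  congr 3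
  ext i
  simp

/-- Functional calculus. -/
def mfun {n : Type*} [Fintype n] [DecidableEq n] (f : ℝ → ℝ) (A : Matrix n n ℂ) :
    Matrix n n ℂ :=
  if h : A.IsHermitian then
    (h.eigenvectorUnitary : Matrix n n ℂ) * diagonal (fun i => (f (h.eigenvalues i) : ℂ)) *
      (h.eigenvectorUnitary : Matrix n n ℂ)ᴴ
  else 0

theorem SpecDec.uniq {n : Type*} [Fintype n] [DecidableEq n] {A U V : Matrix n n ℂ}
    {p q : n → ℝ} (h : SpecDec A U p) (h' : SpecDec A V q) (f : ℝ → ℝ) :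
    U * diagonal (fun i => (f (p i) : ℂ)) * Uᴴ = V * diagonal (fun i => (f (q i) : ℂ)) * Vᴴ := by
  have key : (Vᴴ * U) * diagonal (fun i => (p i : ℂ)) =
      diagonal (fun i => (q i : ℂ)) * (Vᴴ * U) := by
    have e := h.eq.symm.trans h'.eq
    calc (Vᴴ * U) * diagonal (fun i => (p i : ℂ))
        = Vᴴ * (U * diagonal (fun i => (p i : ℂ)) * Uᴴ) * U := by
          simp only [mul_assoc, h.left, mul_one]
      _ = Vᴴ * (V * diagonal (fun i => (q i : ℂ)) * Vᴴ) * U := by rw [e]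
      _ = (Vᴴ * V) * diagonal (fun i => (q i : ℂ)) * (Vᴴ * U) := by simp only [mul_assoc]
      _ = _ := by rw [h'.left, one_mul]
  have key2 : (Vᴴ * U) * diagonal (fun i => (f (p i) : ℂ)) =
      diagonal (fun i => (f (q i) : ℂ)) * (Vᴴ * U) := by
    ext i j
    have := congrFun (congrFun key i) j
    rw [mul_diagonal, diagonal_mul] at this ⊢
    by_cases hz : (Vᴴ * U) i j = 0
    · simp [hz]
    · have h3 : (p j : ℂ) = q i := by
        rw [mul_comm] at this
        exact mul_right_cancel₀ hz this
      have h4 : p j = q i := by exact_mod_cast h3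
      rw [h4, mul_comm]
  calc U * diagonal (fun i => (f (p i) : ℂ)) * Uᴴ
      = V * ((Vᴴ * U) * diagonal (fun i => (f (p i) : ℂ))) * Uᴴ := by
        simp only [← mul_assoc, h'.right, one_mul]
    _ = V * diagonal (fun i => (f (q i) : ℂ)) * Vᴴ * (U * Uᴴ) := by
        rw [key2]; simp only [mul_assoc]
    _ = _ := by rw [h.right, mul_one]

theorem SpecDec.mfun_eq {n : Type*} [Fintype n] [DecidableEq n] {A V : Matrix n n ℂ}
    {q : n → ℝ} (h : SpecDec A V q) (f : ℝ → ℝ) :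
    mfun f A = V * diagonal (fun i => (f (q i) : ℂ)) * Vᴴ := by
  rw [mfun, dif_pos h.hermitian]
  exact (SpecDec.of_hermitian h.hermitian).uniq h f

theorem SpecDec.sum_eq {n : Type*} [Fintype n] [DecidableEq n] {A V : Matrix n n ℂ}
    {q : n → ℝ} (h : SpecDec A V q) (hA : A.IsHermitian) (f : ℝ → ℝ) :
    ∑ i, f (hA.eigenvalues i) = ∑ i, f (q i) := by
  have h1 := SpecDec.of_hermitian hA
  have := congrArg trace (h1.uniq h f)
  rw [trace_mul_comm, ← mul_assoc, h1.left, one_mul, trace_mul_comm, ← mul_assoc, h.left,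
    one_mul, trace_diagonal, trace_diagonal] at this
  exact_mod_cast this

theorem SpecDec.vnEntropy_eq {n : Type*} [Fintype n] [DecidableEq n] {A V : Matrix n n ℂ}
    {q : n → ℝ} (h : SpecDec A V q) : vnEntropy A = ∑ i, Real.negMulLog (q i) := by
  rw [vnEntropy, dif_pos h.hermitian, h.sum_eq]

theorem SpecDec.trace_eq {n : Type*} [Fintype n] [DecidableEq n] {A V : Matrix n n ℂ}
    {q : n → ℝ} (h : SpecDec A V q) : A.trace = ((∑ i, q i : ℝ) : ℂ) := by
  rw [h.eq, trace_mul_comm, ← mul_assoc, h.left, one_mul, trace_diagonal]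
  push_cast; rfl

theorem SpecDec.conj_eq {n : Type*} [Fintype n] [DecidableEq n] {A V : Matrix n n ℂ}
    {q : n → ℝ} (h : SpecDec A V q) : Vᴴ * A * V = diagonal (fun i => (q i : ℂ)) := by
  rw [h.eq]
  calc _ = (Vᴴ * V) * diagonal (fun i => (q i : ℂ)) * (Vᴴ * V) := by simp only [mul_assoc]
    _ = _ := by rw [h.left]; simp

theorem SpecDec.nonneg {n : Type*} [Fintype n] [DecidableEq n] {A V : Matrix n n ℂ}
    {q : n → ℝ} (h : SpecDec A V q) (hA : A.PosSemidef) (i : n) : 0 ≤ q i := by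
  have h1 := hA.conjTranspose_mul_mul_same V
  rw [h.conj_eq] at h1
  have := posSemidef_diagonal_iff.1 h1 i
  exact_mod_cast this

theorem SpecDec.posSemidef {n : Type*} [Fintype n] [DecidableEq n] {A V : Matrix n n ℂ}
    {q : n → ℝ} (h : SpecDec A V q) (hq : ∀ i, 0 ≤ q i) : A.PosSemidef := by
  rw [h.eq]
  apply PosSemidef.mul_mul_conjTranspose_same
  apply PosSemidef.diagonal
  intro i
  show (0 : ℂ) ≤ ((q i : ℝ) : ℂ)
  exact_mod_cast hq i

/-- quadratic functional in the variational formula -/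
def Qf {n : Type*} [Fintype n] (ρ σ : Matrix n n ℂ) (t : ℝ) (Y : Matrix n n ℂ) : ℝ :=
  2 * (trace (ρ * Y)).re - (trace (σ * (Y * Yᴴ))).re - t * (trace (ρ * (Yᴴ * Y))).re

theorem Qf_eq {n : Type*} [Fintype n] [DecidableEq n] {ρ σ U V : Matrix n n ℂ} {p q : n → ℝ}
    (hρ : SpecDec ρ U p) (hσ : SpecDec σ V q) (t : ℝ) (Z : Matrix n n ℂ) :
    Qf ρ σ t (V * Z * Uᴴ) = ∑ i, ∑ j, (2 * p i * ((Uᴴ * V) i j * Z j i).re -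
      (q j + t * p i) * Complex.normSq (Z j i)) := by
  have e1 : trace (ρ * (V * Z * Uᴴ)) = ∑ i, ∑ j, (p i : ℂ) * ((Uᴴ * V) i j * Z j i) := by
    have : ρ * (V * Z * Uᴴ) = U * (diagonal (fun i => (p i : ℂ)) * ((Uᴴ * V) * Z) * Uᴴ) := by
      rw [hρ.eq]; simp only [mul_assoc]
    rw [this, trace_mul_comm]
    have : diagonal (fun i => (p i : ℂ)) * ((Uᴴ * V) * Z) * Uᴴ * U =
      diagonal (fun i => (p i : ℂ)) * ((Uᴴ * V) * Z) := by
      rw [mul_assoc, hρ.left, mul_one]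
    rw [this, trace]
    refine Finset.sum_congr rfl fun i _ => ?_
    rw [diag_apply, diagonal_mul, mul_apply, Finset.mul_sum]
  have e2 : trace (σ * ((V * Z * Uᴴ) * (V * Z * Uᴴ)ᴴ)) =
      ∑ i, ∑ j, (q j : ℂ) * (Complex.normSq (Z j i) : ℂ) := by
    have : σ * ((V * Z * Uᴴ) * (V * Z * Uᴴ)ᴴ) =
        V * (diagonal (fun i => (q i : ℂ)) * (Z * Zᴴ) * Vᴴ) := by
      rw [hσ.eq]
      simp only [conjTranspose_mul, conjTranspose_conjTranspose]
      calc _ = V * diagonal (fun i => (q i : ℂ)) * (Vᴴ * V) * Z * (Uᴴ * U) * Zᴴ * Vᴴ := by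
            simp only [mul_assoc]
        _ = _ := by rw [hσ.left, hρ.left]; simp only [mul_assoc, mul_one]
    rw [this, trace_mul_comm]
    have : diagonal (fun i => (q i : ℂ)) * (Z * Zᴴ) * Vᴴ * V =
      diagonal (fun i => (q i : ℂ)) * (Z * Zᴴ) := by
      rw [mul_assoc, hσ.left, mul_one]
    rw [this, trace, Finset.sum_comm]
    refine Finset.sum_congr rfl fun i _ => ?_
    rw [diag_apply, diagonal_mul, mul_apply, Finset.mul_sum]
    refine Finset.sum_congr rfl fun j _ => ?_
    rw [conjTranspose_apply, Complex.star_def, Complex.mul_conj]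
  have e3 : trace (ρ * ((V * Z * Uᴴ)ᴴ * (V * Z * Uᴴ))) =
      ∑ i, ∑ j, (p i : ℂ) * (Complex.normSq (Z j i) : ℂ) := by
    have : ρ * ((V * Z * Uᴴ)ᴴ * (V * Z * Uᴴ)) =
        U * (diagonal (fun i => (p i : ℂ)) * (Zᴴ * Z) * Uᴴ) := by
      rw [hρ.eq]
      simp only [conjTranspose_mul, conjTranspose_conjTranspose]
      calc _ = U * diagonal (fun i => (p i : ℂ)) * (Uᴴ * U) * Zᴴ * (Vᴴ * V) * Z * Uᴴ := by
            simp only [mul_assoc]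
        _ = _ := by rw [hσ.left, hρ.left]; simp only [mul_assoc, mul_one]
    rw [this, trace_mul_comm]
    have : diagonal (fun i => (p i : ℂ)) * (Zᴴ * Z) * Uᴴ * U =
      diagonal (fun i => (p i : ℂ)) * (Zᴴ * Z) := by
      rw [mul_assoc, hρ.left, mul_one]
    rw [this, trace]
    refine Finset.sum_congr rfl fun i _ => ?_
    rw [diag_apply, diagonal_mul, mul_apply, Finset.mul_sum]
    refine Finset.sum_congr rfl fun j _ => ?_
    rw [conjTranspose_apply, Complex.star_def, mul_comm ((starRingEnd ℂ) _), Complex.mul_conj]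
  rw [Qf, e1, e2, e3]
  simp only [Complex.re_sum, Complex.re_ofReal_mul, Complex.ofReal_re, Finset.mul_sum,
    ← Finset.sum_sub_distrib]
  refine Finset.sum_congr rfl fun i _ => Finset.sum_congr rfl fun j _ => ?_
  ring

theorem scalar_bound (p s : ℝ) (hs : 0 ≤ s) (hp : p ≠ 0 → 0 < s) (w z : ℂ) :
    2 * p * (w * z).re - s * Complex.normSq z ≤ p ^ 2 * Complex.normSq w / s := by
  by_cases h0 : p = 0
  · subst h0
    have := mul_nonneg hs (Complex.normSq_nonneg z)
    simp; linarith
  · have hs' := hp h0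
    rw [le_div_iff₀ hs']
    simp only [Complex.normSq_apply, Complex.mul_re]
    nlinarith [sq_nonneg (p * w.re - s * z.re), sq_nonneg (p * w.im + s * z.im)]

theorem scalar_attained (p s : ℝ) (hp : p ≠ 0 → 0 < s) (w : ℂ) :
    2 * p * (w * ((p / s : ℝ) * star w)).re - s * Complex.normSq ((p / s : ℝ) * star w) =
      p ^ 2 * Complex.normSq w / s := by
  by_cases h0 : p = 0
  · subst h0
    simp
  · have hs' := (hp h0).ne'
    simp only [Complex.normSq_apply, Complex.mul_re, Complex.mul_im, Complex.ofReal_re,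
      Complex.ofReal_im, Complex.star_def, Complex.conj_re, Complex.conj_im]
    field_simp
    ring

/-- value of the supremum of the quadratic functional -/
def Sf {n : Type*} [Fintype n] (W : Matrix n n ℂ) (p q : n → ℝ) (t : ℝ) : ℝ :=
  ∑ i, ∑ j, (p i ^ 2 * Complex.normSq (W i j) / (q j + t * p i))

theorem Qf_le_Sf {n : Type*} [Fintype n] [DecidableEq n] {ρ σ U V : Matrix n n ℂ} {p q : n → ℝ}
    (hρ : SpecDec ρ U p) (hσ : SpecDec σ V q) (hp : ∀ i, 0 ≤ p i) (hq : ∀ i, 0 ≤ q i)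
    {t : ℝ} (ht : 0 < t) (Y : Matrix n n ℂ) :
    Qf ρ σ t Y ≤ Sf (Uᴴ * V) p q t := by
  have : Y = V * (Vᴴ * Y * U) * Uᴴ := by
    calc Y = (V * Vᴴ) * Y * (U * Uᴴ) := by rw [hσ.right, hρ.right]; simp
      _ = _ := by simp only [mul_assoc]
  rw [this, Qf_eq hρ hσ]
  refine Finset.sum_le_sum fun i _ => Finset.sum_le_sum fun j _ => ?_
  refine scalar_bound _ _ ?_ ?_ _ _
  · have := hp i; have := hq j; positivity
  · intro h
    have := lt_of_le_of_ne (hp i) (Ne.symm h); have := hq j; positivity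

theorem exists_Qf_eq_Sf {n : Type*} [Fintype n] [DecidableEq n] {ρ σ U V : Matrix n n ℂ}
    {p q : n → ℝ}
    (hρ : SpecDec ρ U p) (hσ : SpecDec σ V q) (hp : ∀ i, 0 ≤ p i) (hq : ∀ i, 0 ≤ q i)
    {t : ℝ} (ht : 0 < t) : ∃ Y : Matrix n n ℂ, Qf ρ σ t Y = Sf (Uᴴ * V) p q t := by
  refine ⟨V * (Matrix.of fun j i => (((p i / (q j + t * p i) : ℝ) : ℂ) * star ((Uᴴ * V) i j)))
    * Uᴴ, ?_⟩
  rw [Qf_eq hρ hσ]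
  refine Finset.sum_congr rfl fun i _ => Finset.sum_congr rfl fun j _ => ?_
  rw [Matrix.of_apply]
  refine scalar_attained _ _ ?_ _
  · intro h
    have := lt_of_le_of_ne (hp i) (Ne.symm h); have := hq j; positivity

/-- primitive of `Sf` -/
def Gf {n : Type*} [Fintype n] (W : Matrix n n ℂ) (p q : n → ℝ) (t : ℝ) : ℝ :=
  ∑ i, ∑ j, (Complex.normSq (W i j) * p i * Real.log (q j + t * p i))

theorem Gf_hasDerivAt {n : Type*} [Fintype n] (W : Matrix n n ℂ) (p q : n → ℝ)
    (hp : ∀ i, 0 ≤ p i) (hq : ∀ i, 0 ≤ q i) {t : ℝ} (ht : 0 < t) :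
    HasDerivAt (Gf W p q) (Sf W p q t) t := by
  unfold Gf Sf
  refine HasDerivAt.fun_sum fun i _ => HasDerivAt.fun_sum fun j _ => ?_
  by_cases h0 : p i = 0
  · simp only [h0]
    simpa using hasDerivAt_const t (0 : ℝ)
  · have h1 : 0 < p i := lt_of_le_of_ne (hp i) (Ne.symm h0)
    have h2 : 0 < q j + t * p i := by have := hq j; positivity
    have h3 : HasDerivAt (fun x : ℝ => q j + x * p i) (p i) t := by
      simpa using ((hasDerivAt_id t).mul_const (p i)).const_add (q j)
    have := (h3.log h2.ne').const_mul (Complex.normSq (W i j) * p i)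
    refine this.congr_deriv ?_
    ring

theorem Gf_tendsto_zero {n : Type*} [Fintype n] (W : Matrix n n ℂ) (p q : n → ℝ)
    (hs : ∀ i j, q j = 0 → Complex.normSq (W i j) * p i = 0) :
    Filter.Tendsto (Gf W p q) (nhdsWithin 0 (Set.Ioi 0))
      (nhds (∑ i, ∑ j, Complex.normSq (W i j) * p i * Real.log (q j))) := by
  unfold Gf
  refine tendsto_finsetSum _ fun i _ => tendsto_finsetSum _ fun j _ => ?_
  by_cases h : q j = 0
  · simp only [hs i j h, zero_mul]
    exact tendsto_const_nhds
  · refine Filter.Tendsto.const_mul _ ?_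
    refine Filter.Tendsto.mono_left ?_ nhdsWithin_le_nhds
    have h1 : ContinuousAt (fun t : ℝ => Real.log (q j + t * p i)) 0 := by
      apply ContinuousAt.log
      · fun_prop
      · simpa using h
    simpa [ContinuousAt] using h1

theorem Gf_tendsto_top {n : Type*} [Fintype n] (W : Matrix n n ℂ) (p q : n → ℝ)
    (hp : ∀ i, 0 ≤ p i)
    (hW : ∀ i, ∑ j, Complex.normSq (W i j) = 1) :
    Filter.Tendsto (fun t => Gf W p q t - (∑ i, p i) * Real.log t) Filter.atTop
      (nhds (- ∑ i, Real.negMulLog (p i))) := by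
  have e1 : (- ∑ i, Real.negMulLog (p i)) =
      ∑ i, ∑ j, Complex.normSq (W i j) * p i * Real.log (p i) := by
    rw [← Finset.sum_neg_distrib]
    refine Finset.sum_congr rfl fun i _ => ?_
    simp only [mul_assoc]
    rw [← Finset.sum_mul, hW, Real.negMulLog]
    ring
  have e2 : (fun t => Gf W p q t - (∑ i, p i) * Real.log t) = fun t =>
      ∑ i, ∑ j, Complex.normSq (W i j) * p i * (Real.log (q j + t * p i) - Real.log t) := by
    ext t
    simp only [mul_sub, Finset.sum_sub_distrib]
    rw [Gf]
    congr 1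
    rw [Finset.sum_mul]
    refine Finset.sum_congr rfl fun i _ => ?_
    simp only [mul_assoc]
    rw [← Finset.sum_mul, hW, one_mul]
  rw [e1, e2]
  refine tendsto_finsetSum _ fun i _ => tendsto_finsetSum _ fun j _ => ?_
  by_cases h0 : p i = 0
  · simp [h0]
  · have h1 : 0 < p i := lt_of_le_of_ne (hp i) (Ne.symm h0)
    refine Filter.Tendsto.const_mul _ ?_
    have h2 : Filter.Tendsto (fun t : ℝ => q j / t + p i) Filter.atTop (nhds (p i)) := by
      have := (Filter.Tendsto.const_div_atTop (r := q j) (Filter.tendsto_id (α := ℝ))).add_const (p i)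
      simpa using this
    have h3 := h2.log h1.ne'
    refine h3.congr' ?_
    have h4 := h2.eventually (lt_mem_nhds h1)
    filter_upwards [Filter.eventually_gt_atTop (0 : ℝ), h4] with t ht ht2
    have : q j + t * p i = t * (q j / t + p i) := by field_simp
    rw [this, Real.log_mul ht.ne' ht2.ne']
    ring

/-- Relative entropy. -/
def relD {n : Type*} [Fintype n] [DecidableEq n] (ρ σ : Matrix n n ℂ) : ℝ :=
  - vnEntropy ρ - (trace (ρ * mfun Real.log σ)).re

/-- support condition -/
def SuppLe {n : Type*} [Fintype n] (ρ σ : Matrix n n ℂ) : Prop :=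
  ∀ v : n → ℂ, σ *ᵥ v = 0 → ρ *ᵥ v = 0

theorem supp_aux {n : Type*} [Fintype n] [DecidableEq n] {ρ σ U V : Matrix n n ℂ} {p q : n → ℝ}
    (hρ : SpecDec ρ U p) (hσ : SpecDec σ V q) (hs : SuppLe ρ σ) (i j : n) (h : q j = 0) :
    Complex.normSq ((Uᴴ * V) i j) * p i = 0 := by
  have h1 : σ *ᵥ (V *ᵥ Pi.single j 1) = 0 := by
    have : σ * V = V * diagonal (fun i => (q i : ℂ)) := by
      rw [hσ.eq, mul_assoc, hσ.left, mul_one]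
    rw [mulVec_mulVec, this, ← mulVec_mulVec, diagonal_mulVec_single, h]
    simp
  have h2 := hs _ h1
  have h3 : (Uᴴ * (ρ * V)) *ᵥ Pi.single j 1 = 0 := by
    rw [← mulVec_mulVec, ← mulVec_mulVec, h2, mulVec_zero]
  have h4 : Uᴴ * (ρ * V) = diagonal (fun i => (p i : ℂ)) * (Uᴴ * V) := by
    rw [hρ.eq]
    calc _ = (Uᴴ * U) * diagonal (fun i => (p i : ℂ)) * (Uᴴ * V) := by simp only [mul_assoc]
      _ = _ := by rw [hρ.left, one_mul]
  rw [h4, mulVec_single_one] at h3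
  have h5 := congrFun h3 i
  rw [col_apply, diagonal_mul] at h5
  have h5' : p i = 0 ∨ (Uᴴ * V) i j = 0 := by simpa using h5
  rcases h5' with h6 | h6
  · simp [h6]
  · rw [h6]; simp

theorem row_sum {n : Type*} [Fintype n] [DecidableEq n] {U V : Matrix n n ℂ}
    (hU : Uᴴ * U = 1) (hV : V * Vᴴ = 1) (i : n) :
    ∑ j, Complex.normSq ((Uᴴ * V) i j) = 1 := by
  have : (Uᴴ * V) * (Uᴴ * V)ᴴ = 1 := by
    rw [conjTranspose_mul, conjTranspose_conjTranspose]
    calc _ = Uᴴ * (V * Vᴴ) * U := by simp only [mul_assoc]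
      _ = 1 := by rw [hV, mul_one, hU]
  have h := congrFun (congrFun this i) i
  rw [mul_apply, one_apply_eq] at h
  have h2 : ((∑ j, Complex.normSq ((Uᴴ * V) i j) : ℝ) : ℂ) = 1 := by
    rw [← h]
    push_cast
    refine Finset.sum_congr rfl fun j _ => ?_
    rw [conjTranspose_apply, Complex.star_def, Complex.mul_conj]
  exact_mod_cast h2

theorem trace_log_eq {n : Type*} [Fintype n] [DecidableEq n] {ρ σ U V : Matrix n n ℂ}
    {p q : n → ℝ} (hρ : SpecDec ρ U p) (hσ : SpecDec σ V q) :
    (trace (ρ * mfun Real.log σ)).re =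
      ∑ i, ∑ j, Complex.normSq ((Uᴴ * V) i j) * p i * Real.log (q j) := by
  rw [hσ.mfun_eq, hρ.eq]
  have : U * diagonal (fun i => (p i : ℂ)) * Uᴴ *
      (V * diagonal (fun i => (Real.log (q i) : ℂ)) * Vᴴ) =
      U * (diagonal (fun i => (p i : ℂ)) * ((Uᴴ * V) *
        (diagonal (fun i => (Real.log (q i) : ℂ)) * Vᴴ))) := by simp only [mul_assoc]
  rw [this, trace_mul_comm]
  have : diagonal (fun i => (p i : ℂ)) * ((Uᴴ * V) *
        (diagonal (fun i => (Real.log (q i) : ℂ)) * Vᴴ)) * U =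
      diagonal (fun i => (p i : ℂ)) * ((Uᴴ * V) *
        (diagonal (fun i => (Real.log (q i) : ℂ)) * (Uᴴ * V)ᴴ)) := by
    simp only [mul_assoc, conjTranspose_mul, conjTranspose_conjTranspose]
  rw [this, trace, Complex.re_sum]
  refine Finset.sum_congr rfl fun i _ => ?_
  rw [diag_apply, diagonal_mul, mul_apply, Complex.re_ofReal_mul, Complex.re_sum, Finset.mul_sum]
  refine Finset.sum_congr rfl fun j _ => ?_
  rw [diagonal_mul, conjTranspose_apply, Complex.star_def, mul_left_comm, Complex.mul_conj,
    ← Complex.ofReal_mul, Complex.ofReal_re]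
  ring

theorem key_lemma {n m : Type*} [Fintype n] [DecidableEq n] [Fintype m] [DecidableEq m]
    {ρ₁ σ₁ ρ₂ σ₂ : Matrix n n ℂ} {ρ σ : Matrix m m ℂ} {c₁ c₂ : ℝ}
    (hc₁ : 0 ≤ c₁) (hc₂ : 0 ≤ c₂)
    (hρ₁ : ρ₁.PosSemidef) (hσ₁ : σ₁.PosSemidef) (hρ₂ : ρ₂.PosSemidef) (hσ₂ : σ₂.PosSemidef)
    (hρ : ρ.PosSemidef) (hσ : σ.PosSemidef)
    (s₁ : SuppLe ρ₁ σ₁) (s₂ : SuppLe ρ₂ σ₂) (s : SuppLe ρ σ)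
    (htr : ρ.trace.re = c₁ * ρ₁.trace.re + c₂ * ρ₂.trace.re)
    (hY : ∀ t > 0, ∀ Y, ∃ Y₁ Y₂, Qf ρ σ t Y ≤ c₁ * Qf ρ₁ σ₁ t Y₁ + c₂ * Qf ρ₂ σ₂ t Y₂) :
    relD ρ σ ≤ c₁ * relD ρ₁ σ₁ + c₂ * relD ρ₂ σ₂ := by
  have dρ := SpecDec.of_hermitian hρ.1
  have dσ := SpecDec.of_hermitian hσ.1
  have dρ₁ := SpecDec.of_hermitian hρ₁.1
  have dσ₁ := SpecDec.of_hermitian hσ₁.1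
  have dρ₂ := SpecDec.of_hermitian hρ₂.1
  have dσ₂ := SpecDec.of_hermitian hσ₂.1
  generalize (hρ.1.eigenvectorUnitary : Matrix m m ℂ) = U at dρ
  generalize (hσ.1.eigenvectorUnitary : Matrix m m ℂ) = V at dσ
  generalize (hρ₁.1.eigenvectorUnitary : Matrix n n ℂ) = U₁ at dρ₁
  generalize (hσ₁.1.eigenvectorUnitary : Matrix n n ℂ) = V₁ at dσ₁
  generalize (hρ₂.1.eigenvectorUnitary : Matrix n n ℂ) = U₂ at dρ₂
  generalize (hσ₂.1.eigenvectorUnitary : Matrix n n ℂ) = V₂ at dσ₂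
  generalize hρ.1.eigenvalues = p at dρ
  generalize hσ.1.eigenvalues = q at dσ
  generalize hρ₁.1.eigenvalues = p₁ at dρ₁
  generalize hσ₁.1.eigenvalues = q₁ at dσ₁
  generalize hρ₂.1.eigenvalues = p₂ at dρ₂
  generalize hσ₂.1.eigenvalues = q₂ at dσ₂
  have hp := dρ.nonneg hρ
  have hq := dσ.nonneg hσ
  have hp₁ := dρ₁.nonneg hρ₁
  have hq₁ := dσ₁.nonneg hσ₁
  have hp₂ := dρ₂.nonneg hρ₂
  have hq₂ := dσ₂.nonneg hσ₂
  set G := Gf (Uᴴ * V) p q with hG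
  set G₁ := Gf (U₁ᴴ * V₁) p₁ q₁ with hG₁
  set G₂ := Gf (U₂ᴴ * V₂) p₂ q₂ with hG₂
  have hder : ∀ t : ℝ, 0 < t → HasDerivAt (fun t => c₁ * G₁ t + c₂ * G₂ t - G t)
      (c₁ * Sf (U₁ᴴ * V₁) p₁ q₁ t + c₂ * Sf (U₂ᴴ * V₂) p₂ q₂ t - Sf (Uᴴ * V) p q t) t := by
    intro t ht
    exact (((Gf_hasDerivAt _ _ _ hp₁ hq₁ ht).const_mul c₁).add
      ((Gf_hasDerivAt _ _ _ hp₂ hq₂ ht).const_mul c₂)).sub (Gf_hasDerivAt _ _ _ hp hq ht)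
  have hmono : MonotoneOn (fun t => c₁ * G₁ t + c₂ * G₂ t - G t) (Set.Ioi 0) := by
    apply monotoneOn_of_deriv_nonneg (convex_Ioi 0)
    · intro t ht
      exact (hder t ht).continuousAt.continuousWithinAt
    · intro t ht
      rw [interior_Ioi] at ht
      exact (hder t ht).differentiableAt.differentiableWithinAt
    · intro t ht
      rw [interior_Ioi] at ht
      rw [(hder t ht).deriv]
      obtain ⟨Y, hYe⟩ := exists_Qf_eq_Sf dρ dσ hp hq ht
      obtain ⟨Y₁, Y₂, h⟩ := hY t ht Y
      have h1 := mul_le_mul_of_nonneg_left (Qf_le_Sf dρ₁ dσ₁ hp₁ hq₁ ht Y₁) hc₁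
      have h2 := mul_le_mul_of_nonneg_left (Qf_le_Sf dρ₂ dσ₂ hp₂ hq₂ ht Y₂) hc₂
      linarith
  have l0 := (((Gf_tendsto_zero (U₁ᴴ * V₁) p₁ q₁ (fun i j => supp_aux dρ₁ dσ₁ s₁ i j)).const_mul
    c₁).add ((Gf_tendsto_zero (U₂ᴴ * V₂) p₂ q₂ (fun i j => supp_aux dρ₂ dσ₂ s₂ i j)).const_mul
    c₂)).sub (Gf_tendsto_zero (Uᴴ * V) p q (fun i j => supp_aux dρ dσ s i j))
  have l1 := (((Gf_tendsto_top (U₁ᴴ * V₁) p₁ q₁ hp₁ (row_sum dρ₁.left dσ₁.right)).const_mul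
    c₁).add ((Gf_tendsto_top (U₂ᴴ * V₂) p₂ q₂ hp₂ (row_sum dρ₂.left dσ₂.right)).const_mul
    c₂)).sub (Gf_tendsto_top (Uᴴ * V) p q hp (row_sum dρ.left dσ.right))
  have t0 := dρ.trace_eq
  have t1 := dρ₁.trace_eq
  have t2 := dρ₂.trace_eq
  rw [t0, t1, t2] at htr
  simp only [Complex.ofReal_re] at htr
  rw [← trace_log_eq dρ dσ, ← trace_log_eq dρ₁ dσ₁, ← trace_log_eq dρ₂ dσ₂] at l0
  rw [← dρ.vnEntropy_eq, ← dρ₁.vnEntropy_eq, ← dρ₂.vnEntropy_eq] at l1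
  have b : ∀ t : ℝ, 0 < t → c₁ * (trace (ρ₁ * mfun Real.log σ₁)).re +
      c₂ * (trace (ρ₂ * mfun Real.log σ₂)).re - (trace (ρ * mfun Real.log σ)).re ≤
      c₁ * G₁ t + c₂ * G₂ t - G t := by
    intro t ht
    refine le_of_tendsto l0 ?_
    filter_upwards [Ioc_mem_nhdsGT ht] with x hx
    exact hmono hx.1 ht hx.2
  have b2 : c₁ * (trace (ρ₁ * mfun Real.log σ₁)).re +
      c₂ * (trace (ρ₂ * mfun Real.log σ₂)).re - (trace (ρ * mfun Real.log σ)).re ≤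
      c₁ * -vnEntropy ρ₁ + c₂ * -vnEntropy ρ₂ - -vnEntropy ρ := by
    refine ge_of_tendsto l1 ?_
    filter_upwards [Filter.eventually_gt_atTop (0 : ℝ)] with t ht
    refine (b t ht).trans (le_of_eq ?_)
    rw [htr]
    simp only [hG, hG₁, hG₂]
    ring
  unfold relD
  linarith

open scoped Kronecker

theorem suppLe_of_le {n : Type*} [Fintype n] {ρ σ : Matrix n n ℂ} (hρ : ρ.PosSemidef)
    (K : ℂ) (h : (K • σ - ρ).PosSemidef) : SuppLe ρ σ := by
  intro v hv
  rw [← hρ.dotProduct_mulVec_zero_iff]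
  have h1 := h.dotProduct_mulVec_nonneg v
  rw [sub_mulVec, smul_mulVec, hv, smul_zero, zero_sub, dotProduct_neg] at h1
  exact le_antisymm (neg_nonneg.1 h1) (hρ.dotProduct_mulVec_nonneg v)

theorem relD_dpi {n m : Type*} [Fintype n] [DecidableEq n] [Fintype m] [DecidableEq m]
    {ρ σ : Matrix n n ℂ} {ρ' σ' : Matrix m m ℂ} (φ : Matrix m m ℂ → Matrix n n ℂ)
    (hmul : ∀ X Y, φ (X * Y) = φ X * φ Y) (hstar : ∀ X, φ Xᴴ = (φ X)ᴴ) (hone : φ 1 = 1)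
    (hρ : ρ.PosSemidef) (hσ : σ.PosSemidef) (hρ' : ρ'.PosSemidef) (hσ' : σ'.PosSemidef)
    (s : SuppLe ρ σ) (s' : SuppLe ρ' σ')
    (e : ∀ Y, trace (ρ' * Y) = trace (ρ * φ Y)) (e' : ∀ Y, trace (σ' * Y) = trace (σ * φ Y)) :
    relD ρ' σ' ≤ relD ρ σ := by
  have := key_lemma (c₁ := 1) (c₂ := 0) zero_le_one le_rfl hρ hσ hρ hσ hρ' hσ' s s s'
    (by have := e 1; rw [hone, mul_one, mul_one] at this; rw [this]; ring)
    (fun t _ Y => ⟨φ Y, φ Y, by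
      simp only [Qf, e, e', hmul, hstar]
      linarith⟩)
  linarith

theorem relD_convex {n : Type*} [Fintype n] [DecidableEq n]
    {ρ₁ σ₁ ρ₂ σ₂ : Matrix n n ℂ} {c₁ c₂ : ℝ}
    (hc₁ : 0 ≤ c₁) (hc₂ : 0 ≤ c₂)
    (hρ₁ : ρ₁.PosSemidef) (hσ₁ : σ₁.PosSemidef) (hρ₂ : ρ₂.PosSemidef) (hσ₂ : σ₂.PosSemidef)
    (hρ : ((c₁ : ℂ) • ρ₁ + (c₂ : ℂ) • ρ₂).PosSemidef)
    (hσ : ((c₁ : ℂ) • σ₁ + (c₂ : ℂ) • σ₂).PosSemidef)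
    (s₁ : SuppLe ρ₁ σ₁) (s₂ : SuppLe ρ₂ σ₂)
    (s : SuppLe ((c₁ : ℂ) • ρ₁ + (c₂ : ℂ) • ρ₂) ((c₁ : ℂ) • σ₁ + (c₂ : ℂ) • σ₂)) :
    relD ((c₁ : ℂ) • ρ₁ + (c₂ : ℂ) • ρ₂) ((c₁ : ℂ) • σ₁ + (c₂ : ℂ) • σ₂) ≤
      c₁ * relD ρ₁ σ₁ + c₂ * relD ρ₂ σ₂ := by
  refine key_lemma hc₁ hc₂ hρ₁ hσ₁ hρ₂ hσ₂ hρ hσ s₁ s₂ s ?_ ?_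
  · simp [trace_add, trace_smul]
  · intro t _ Y
    refine ⟨Y, Y, le_of_eq ?_⟩
    simp only [Qf, add_mul, smul_mul, trace_add, trace_smul, smul_eq_mul, Complex.add_re,
      Complex.re_ofReal_mul]
    ring

theorem relD_anti {n : Type*} [Fintype n] [DecidableEq n] {ρ σ σ' : Matrix n n ℂ}
    (hρ : ρ.PosSemidef) (hσ : σ.PosSemidef) (hσ' : σ'.PosSemidef) (h : (σ' - σ).PosSemidef)
    (s : SuppLe ρ σ) : relD ρ σ' ≤ relD ρ σ := by
  have s' : SuppLe ρ σ' := fun v hv =>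
    s v (suppLe_of_le hσ 1 (by simpa using h) v hv)
  have := key_lemma (c₁ := 1) (c₂ := 0) zero_le_one le_rfl hρ hσ hρ hσ hρ hσ' s s s'
    (by ring)
    (fun t _ Y => ⟨Y, Y, by
      have h1 := (h.conjTranspose_mul_mul_same Y).trace_nonneg
      have h2 : trace (Yᴴ * (σ' - σ) * Y) = trace (σ' * (Y * Yᴴ)) - trace (σ * (Y * Yᴴ)) := by
        rw [mul_assoc, trace_mul_comm, sub_mul, sub_mul, trace_sub, mul_assoc, mul_assoc]
      rw [h2] at h1
      have h3 := (Complex.le_def.1 h1).1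
      simp only [Complex.zero_re, Complex.sub_re] at h3
      simp only [Qf]
      linarith⟩)
  linarith

theorem SpecDec.smul {n : Type*} [Fintype n] [DecidableEq n] {A V : Matrix n n ℂ}
    {q : n → ℝ} (h : SpecDec A V q) (c : ℝ) : SpecDec ((c : ℂ) • A) V (fun i => c * q i) := by
  refine ⟨h.left, h.right, ?_⟩
  conv_lhs => rw [h.eq]
  rw [← Matrix.smul_mul, ← Matrix.mul_smul, ← diagonal_smul]
  congr 3
  ext i
  simp

theorem trace_self_log {n : Type*} [Fintype n] [DecidableEq n] {ρ : Matrix n n ℂ}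
    (hρ : ρ.IsHermitian) : (trace (ρ * mfun Real.log ρ)).re = - vnEntropy ρ := by
  have d := SpecDec.of_hermitian hρ
  rw [trace_log_eq d d, d.vnEntropy_eq, d.left, ← Finset.sum_neg_distrib]
  refine Finset.sum_congr rfl fun i _ => ?_
  rw [Finset.sum_eq_single i]
  · simp [Real.negMulLog]
  · intro j _ hj
    simp [one_apply_ne hj.symm]
  · simp

theorem relD_smul_self {n : Type*} [Fintype n] [DecidableEq n] {ρ : Matrix n n ℂ}
    (hρ : ρ.IsHermitian) {c : ℝ} (hc : 0 < c) :
    relD ρ ((c : ℂ) • ρ) = - Real.log c * ρ.trace.re := by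
  have d := SpecDec.of_hermitian hρ
  have d' := d.smul c
  rw [relD, trace_log_eq d d', d.vnEntropy_eq, d.left, d.trace_eq, Complex.ofReal_re,
    ← Finset.sum_neg_distrib, ← Finset.sum_sub_distrib, Finset.mul_sum]
  refine Finset.sum_congr rfl fun i _ => ?_
  rw [Finset.sum_eq_single i]
  · by_cases h : hρ.eigenvalues i = 0
    · simp [h]
    · rw [Real.log_mul hc.ne' h]
      simp [Real.negMulLog]
      ring
  · intro j _ hj
    simp [one_apply_ne hj.symm]
  · simp

theorem SpecDec.one {n : Type*} [Fintype n] [DecidableEq n] :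
    SpecDec (1 : Matrix n n ℂ) 1 (fun _ => 1) := by
  refine ⟨by simp, by simp, by simp⟩

theorem relD_one {n : Type*} [Fintype n] [DecidableEq n] (ρ : Matrix n n ℂ) :
    relD ρ 1 = - vnEntropy ρ := by
  rw [relD, SpecDec.one.mfun_eq]
  simp

/-- partial trace over the first factor -/
def ptr {a x : Type*} [Fintype a] (ρ : Matrix (a × x) (a × x) ℂ) : Matrix x x ℂ :=
  fun i j => ∑ k : a, ρ (k, i) (k, j)

theorem ptr_trace_mul {a x : Type*} [Fintype a] [DecidableEq a] [Fintype x]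
    (ρ : Matrix (a × x) (a × x) ℂ) (Y : Matrix x x ℂ) :
    trace (ptr ρ * Y) = trace (ρ * ((1 : Matrix a a ℂ) ⊗ₖ Y)) := by
  simp only [trace, diag_apply, mul_apply, ptr, kroneckerMap_apply, Fintype.sum_prod_type,
    Finset.sum_mul]
  have : ∀ (k : a) (i : x) , ∑ k' : a, ∑ j : x, ρ (k, i) (k', j) * ((1 : Matrix a a ℂ) k' k * Y j i)
      = ∑ j, ρ (k, i) (k, j) * Y j i := by
    intro k i
    rw [Finset.sum_eq_single k]
    · simp
    · intro b _ hb
      simp [one_apply_ne hb]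
    · simp
  simp only [this]
  rw [Finset.sum_comm' (t' := Finset.univ) (s' := fun _ => Finset.univ) (by simp)]
  conv_lhs =>
    enter [2, y]
  refine (Finset.sum_congr rfl fun j _ => Finset.sum_comm).trans ?_
  rw [Finset.sum_comm]
  refine (Finset.sum_congr rfl fun j _ => Finset.sum_comm).trans rfl

theorem ptr_posSemidef {a x : Type*} [Fintype a] [Fintype x]
    {ρ : Matrix (a × x) (a × x) ℂ} (hρ : ρ.PosSemidef) : (ptr ρ).PosSemidef := by
  have : ptr ρ = ∑ k : a, ρ.submatrix (fun i => (k, i)) (fun i => (k, i)) := by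
    ext i j
    simp [ptr, Matrix.sum_apply]
  rw [this]
  exact posSemidef_sum _ fun k _ => hρ.submatrix _

theorem ptr_trace {a x : Type*} [Fintype a] [DecidableEq a] [Fintype x] [DecidableEq x]
    (ρ : Matrix (a × x) (a × x) ℂ) : (ptr ρ).trace = ρ.trace := by
  have := ptr_trace_mul ρ 1
  rwa [one_kronecker_one, mul_one, mul_one] at this

theorem le_card_ptr {a x : Type*} [Fintype a] [DecidableEq a] [Fintype x] [DecidableEq x]
    {ρ : Matrix (a × x) (a × x) ℂ} (hρ : ρ.PosSemidef) :
    ((Fintype.card a : ℂ) • ((1 : Matrix a a ℂ) ⊗ₖ ptr ρ) - ρ).PosSemidef := by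
  have id : (Fintype.card a : ℂ) • ((1 : Matrix a a ℂ) ⊗ₖ ptr ρ) - ρ =
      (1 / 2 : ℂ) • (∑ k : a, ∑ l : a,
        (diagonal (fun i : a × x => (if i.1 = k then (1 : ℂ) else 0) - if i.1 = l then 1 else 0)) *
        ρ * (diagonal (fun i : a × x =>
          (if i.1 = k then (1 : ℂ) else 0) - if i.1 = l then 1 else 0))ᴴ) +
      (Fintype.card a : ℂ) • ∑ k : a, (diagonal (fun i : a => if i = k then (0 : ℂ) else 1)) ⊗ₖ
        (ρ.submatrix (fun i : x => (k, i)) (fun i : x => (k, i))) := by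
    ext ⟨c, i⟩ ⟨c', j⟩
    have e1 : ∀ k l : a, ((diagonal (fun i : a × x => (if i.1 = k then (1 : ℂ) else 0) -
        if i.1 = l then 1 else 0)) *
        ρ * (diagonal (fun i : a × x =>
          (if i.1 = k then (1 : ℂ) else 0) - if i.1 = l then 1 else 0))ᴴ) (c, i) (c', j) =
        ((if c = k then (1 : ℂ) else 0) - if c = l then 1 else 0) * ρ (c, i) (c', j) *
        ((if c' = k then (1 : ℂ) else 0) - if c' = l then 1 else 0) := by
      intro k l
      rw [diagonal_conjTranspose, mul_diagonal, diagonal_mul]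
      congr 1
      simp only [Pi.star_apply, star_sub]
      congr 1 <;> split_ifs <;> simp
    simp only [Matrix.sub_apply, Matrix.add_apply, Matrix.smul_apply, Matrix.sum_apply, e1, kroneckerMap_apply,
      submatrix_apply, smul_eq_mul, ptr]
    by_cases hc : c = c'
    · subst hc
      simp only [one_apply_eq, one_mul, diagonal_apply_eq, ite_mul, zero_mul]
      have h1 : ∑ k : a, ∑ l : a, ((if c = k then (1 : ℂ) else 0) - if c = l then 1 else 0) *
        ρ (c, i) (c, j) * ((if c = k then (1 : ℂ) else 0) - if c = l then 1 else 0) =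
        (2 * (Fintype.card a : ℂ) - 2) * ρ (c, i) (c, j) := by
        have : ∀ k l : a, ((if c = k then (1 : ℂ) else 0) - if c = l then 1 else 0) *
          ρ (c, i) (c, j) * ((if c = k then (1 : ℂ) else 0) - if c = l then 1 else 0) =
          ((if c = k then (1 : ℂ) else 0) + (if c = l then (1 : ℂ) else 0) -
            2 * ((if c = k then (1 : ℂ) else 0) * (if c = l then (1 : ℂ) else 0))) *
            ρ (c, i) (c, j) := by
          intro k l
          split_ifs <;> ring
        simp only [this, ← Finset.sum_mul, Finset.sum_sub_distrib, Finset.sum_add_distrib,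
          ← Finset.mul_sum]
        simp
        ring_nf
        tauto
      rw [h1]
      have h2 : ∑ k : a, ρ (k, i) (k, j) =
          ρ (c, i) (c, j) + ∑ k : a, if c = k then 0 else ρ (k, i) (k, j) := by
        rw [← Finset.add_sum_erase _ _ (Finset.mem_univ c)]
        congr 1
        rw [← Finset.add_sum_erase _ (fun k => if c = k then 0 else ρ (k, i) (k, j))
          (Finset.mem_univ c)]
        simp only [if_true, zero_add]
        refine Finset.sum_congr rfl fun k hk => ?_
        rw [if_neg (Finset.ne_of_mem_erase hk).symm]
      rw [h2]
      ring
    · have h1 : ∑ k : a, ∑ l : a, ((if c = k then (1 : ℂ) else 0) - if c = l then 1 else 0) *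
        ρ (c, i) (c', j) * ((if c' = k then (1 : ℂ) else 0) - if c' = l then 1 else 0) =
        - 2 * ρ (c, i) (c', j) := by
        have : ∀ k l : a, ((if c = k then (1 : ℂ) else 0) - if c = l then 1 else 0) *
          ρ (c, i) (c', j) * ((if c' = k then (1 : ℂ) else 0) - if c' = l then 1 else 0) =
          (-((if c = k then (1 : ℂ) else 0) * (if c' = l then (1 : ℂ) else 0)) -
            ((if c' = k then (1 : ℂ) else 0) * (if c = l then (1 : ℂ) else 0))) *
            ρ (c, i) (c', j) := by
          intro k l
          have hz : ∀ k : a, (if c = k then (1 : ℂ) else 0) * (if c' = k then (1 : ℂ) else 0) = 0 := by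
            intro k
            split_ifs with h1 h2
            · exact absurd (h1.trans h2.symm) hc
            all_goals simp
          linear_combination ρ (c, i) (c', j) * (hz k + hz l)
        simp only [this, ← Finset.sum_mul, Finset.sum_sub_distrib, Finset.sum_neg_distrib,
          ← Finset.mul_sum]
        simp
        ring_nf
      rw [h1]
      simp [one_apply_ne hc, diagonal_apply_ne _ hc]
  rw [id]
  refine PosSemidef.add (PosSemidef.smul ?_ ?_) (PosSemidef.smul ?_ ?_)
  · exact posSemidef_sum _ fun k _ => posSemidef_sum _ fun l _ =>
      hρ.mul_mul_conjTranspose_same _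
  · rw [Complex.le_def]; norm_num
  · refine posSemidef_sum _ fun k _ => PosSemidef.kronecker ?_ (hρ.submatrix _)
    refine PosSemidef.diagonal fun i => ?_
    simp only [Pi.zero_apply]
    split_ifs <;> simp
  · exact_mod_cast Nat.zero_le _

theorem SpecDec.one_kron {a x : Type*} [Fintype a] [DecidableEq a] [Fintype x] [DecidableEq x]
    {A V : Matrix x x ℂ} {q : x → ℝ} (h : SpecDec A V q) :
    SpecDec ((1 : Matrix a a ℂ) ⊗ₖ A) ((1 : Matrix a a ℂ) ⊗ₖ V) (fun i => q i.2) := by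
  refine ⟨?_, ?_, ?_⟩
  · rw [conjTranspose_kronecker, ← mul_kronecker_mul, h.left]; simp
  · rw [conjTranspose_kronecker, ← mul_kronecker_mul, h.right]; simp
  · have : diagonal (fun i : a × x => (q i.2 : ℂ)) =
        (1 : Matrix a a ℂ) ⊗ₖ diagonal (fun i => (q i : ℂ)) := by
      rw [← diagonal_one, diagonal_kronecker_diagonal]
      simp
    rw [this, conjTranspose_kronecker, ← mul_kronecker_mul, ← mul_kronecker_mul, ← h.eq]
    simp

theorem relD_ptr {a x : Type*} [Fintype a] [DecidableEq a] [Fintype x] [DecidableEq x]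
    {ρ : Matrix (a × x) (a × x) ℂ} (hρ : ρ.PosSemidef) :
    relD ρ ((1 : Matrix a a ℂ) ⊗ₖ ptr ρ) = - vnEntropy ρ + vnEntropy (ptr ρ) := by
  have h := (ptr_posSemidef hρ).1
  have d := SpecDec.of_hermitian h
  have e : mfun Real.log ((1 : Matrix a a ℂ) ⊗ₖ ptr ρ) =
      (1 : Matrix a a ℂ) ⊗ₖ mfun Real.log (ptr ρ) := by
    rw [d.one_kron.mfun_eq, d.mfun_eq]
    have : diagonal (fun i : a × x => (Real.log (h.eigenvalues i.2) : ℂ)) =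
        (1 : Matrix a a ℂ) ⊗ₖ diagonal (fun i => (Real.log (h.eigenvalues i) : ℂ)) := by
      rw [← diagonal_one, diagonal_kronecker_diagonal]
      simp
    rw [this, conjTranspose_kronecker, ← mul_kronecker_mul, ← mul_kronecker_mul]
    simp
  rw [relD, e, ← ptr_trace_mul, trace_self_log h]
  ring

theorem suppLe_ptr {a x : Type*} [Fintype a] [DecidableEq a] [Fintype x] [DecidableEq x]
    {ρ : Matrix (a × x) (a × x) ℂ} (hρ : ρ.PosSemidef) :
    SuppLe ρ ((1 : Matrix a a ℂ) ⊗ₖ ptr ρ) :=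
  suppLe_of_le hρ _ (le_card_ptr hρ)

theorem one_kron_posSemidef {a x : Type*} [Fintype a] [DecidableEq a] [Fintype x] [DecidableEq x]
    {ρ : Matrix x x ℂ} (hρ : ρ.PosSemidef) : ((1 : Matrix a a ℂ) ⊗ₖ ρ).PosSemidef :=
  PosSemidef.kronecker PosSemidef.one hρ

theorem mix_posSemidef {n : Type*} {ρ₁ ρ₂ : Matrix n n ℂ} {c₁ c₂ : ℝ}
    (hc₁ : 0 ≤ c₁) (hc₂ : 0 ≤ c₂) (h₁ : ρ₁.PosSemidef) (h₂ : ρ₂.PosSemidef) :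
    ((c₁ : ℂ) • ρ₁ + (c₂ : ℂ) • ρ₂).PosSemidef :=
  (h₁.smul (by exact_mod_cast hc₁)).add (h₂.smul (by exact_mod_cast hc₂))

theorem suppLe_one {n : Type*} [Fintype n] [DecidableEq n] (ρ : Matrix n n ℂ) : SuppLe ρ 1 := by
  intro v hv
  rw [one_mulVec] at hv
  rw [hv, mulVec_zero]

theorem entropy_concave {n : Type*} [Fintype n] [DecidableEq n] {ρ₁ ρ₂ : Matrix n n ℂ}
    {c₁ c₂ : ℝ} (hc₁ : 0 ≤ c₁) (hc₂ : 0 ≤ c₂) (hc : c₁ + c₂ = 1)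
    (h₁ : ρ₁.PosSemidef) (h₂ : ρ₂.PosSemidef) :
    c₁ * vnEntropy ρ₁ + c₂ * vnEntropy ρ₂ ≤ vnEntropy ((c₁ : ℂ) • ρ₁ + (c₂ : ℂ) • ρ₂) := by
  have e : (c₁ : ℂ) • (1 : Matrix n n ℂ) + (c₂ : ℂ) • (1 : Matrix n n ℂ) = 1 := by
    rw [← add_smul, ← Complex.ofReal_add, hc]; simp
  have := relD_convex hc₁ hc₂ h₁ PosSemidef.one h₂ PosSemidef.one (mix_posSemidef hc₁ hc₂ h₁ h₂)
    (by rw [e]; exact PosSemidef.one) (suppLe_one _) (suppLe_one _) (by rw [e]; exact suppLe_one _)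
  rw [e, relD_one, relD_one, relD_one] at this
  linarith

theorem suppLe_smul_self {n : Type*} [Fintype n] (ρ : Matrix n n ℂ) {c : ℝ}
    (hc : c ≠ 0) : SuppLe ρ ((c : ℂ) • ρ) := by
  intro v hv
  rw [smul_mulVec] at hv
  exact (smul_eq_zero.1 hv).resolve_left (by exact_mod_cast hc)

theorem entropy_mix_le {n : Type*} [Fintype n] [DecidableEq n] {ρ₁ ρ₂ : Matrix n n ℂ}
    {c₁ c₂ : ℝ} (hc₁ : 0 < c₁) (hc₂ : 0 < c₂)
    (h₁ : IsState ρ₁) (h₂ : IsState ρ₂) :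
    vnEntropy ((c₁ : ℂ) • ρ₁ + (c₂ : ℂ) • ρ₂) ≤ c₁ * vnEntropy ρ₁ + c₂ * vnEntropy ρ₂
      + (Real.negMulLog c₁ + Real.negMulLog c₂) := by
  have p₁ : ((c₁ : ℂ) • ρ₁).PosSemidef := h₁.1.smul (by exact_mod_cast hc₁.le)
  have p₂ : ((c₂ : ℂ) • ρ₂).PosSemidef := h₂.1.smul (by exact_mod_cast hc₂.le)
  have hω := mix_posSemidef hc₁.le hc₂.le h₁.1 h₂.1
  have a₁ := relD_anti (σ' := (c₁ : ℂ) • ρ₁ + (c₂ : ℂ) • ρ₂) h₁.1 p₁ hω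
    (by simpa using p₂) (suppLe_smul_self ρ₁ hc₁.ne')
  have a₂ := relD_anti (σ' := (c₁ : ℂ) • ρ₁ + (c₂ : ℂ) • ρ₂) h₂.1 p₂ hω
    (by simpa using p₁) (suppLe_smul_self ρ₂ hc₂.ne')
  rw [relD_smul_self h₁.1.1 hc₁, h₁.2] at a₁
  rw [relD_smul_self h₂.1.1 hc₂, h₂.2] at a₂


  have t2 : (trace (((c₁ : ℂ) • ρ₁ + (c₂ : ℂ) • ρ₂) * mfun Real.log ((c₁ : ℂ) • ρ₁ + (c₂ : ℂ) • ρ₂))).re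
    = c₁ * (trace (ρ₁ * mfun Real.log ((c₁ : ℂ) • ρ₁ + (c₂ : ℂ) • ρ₂))).re +
      c₂ * (trace (ρ₂ * mfun Real.log ((c₁ : ℂ) • ρ₁ + (c₂ : ℂ) • ρ₂))).re := by
    generalize mfun Real.log ((c₁ : ℂ) • ρ₁ + (c₂ : ℂ) • ρ₂) = L
    simp only [add_mul, smul_mul, trace_add, trace_smul, smul_eq_mul, Complex.add_re,
      Complex.re_ofReal_mul]
  rw [trace_self_log hω.1] at t2
  unfold relD at a₁ a₂
  simp only [Complex.one_re, mul_one] at a₁ a₂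
  have b₁ := mul_le_mul_of_nonneg_left a₁ hc₁.le
  have b₂ := mul_le_mul_of_nonneg_left a₂ hc₂.le
  unfold Real.negMulLog
  linarith

theorem ptr_mix {a x : Type*} [Fintype a] (ρ₁ ρ₂ : Matrix (a × x) (a × x) ℂ) (c₁ c₂ : ℂ) :
    ptr (c₁ • ρ₁ + c₂ • ρ₂) = c₁ • ptr ρ₁ + c₂ • ptr ρ₂ := by
  ext i j
  simp [ptr, Finset.sum_add_distrib, Finset.mul_sum]

theorem cond_concave {a x : Type*} [Fintype a] [DecidableEq a] [Fintype x] [DecidableEq x]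
    {ρ₁ ρ₂ : Matrix (a × x) (a × x) ℂ}
    {c₁ c₂ : ℝ} (hc₁ : 0 ≤ c₁) (hc₂ : 0 ≤ c₂)
    (h₁ : ρ₁.PosSemidef) (h₂ : ρ₂.PosSemidef) :
    c₁ * (vnEntropy ρ₁ - vnEntropy (ptr ρ₁)) + c₂ * (vnEntropy ρ₂ - vnEntropy (ptr ρ₂)) ≤
      vnEntropy ((c₁ : ℂ) • ρ₁ + (c₂ : ℂ) • ρ₂) -
      vnEntropy ((c₁ : ℂ) • ptr ρ₁ + (c₂ : ℂ) • ptr ρ₂) := by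
  have e : (c₁ : ℂ) • ((1 : Matrix a a ℂ) ⊗ₖ ptr ρ₁) + (c₂ : ℂ) • ((1 : Matrix a a ℂ) ⊗ₖ ptr ρ₂) =
      (1 : Matrix a a ℂ) ⊗ₖ ptr ((c₁ : ℂ) • ρ₁ + (c₂ : ℂ) • ρ₂) := by
    rw [ptr_mix, kronecker_add, kronecker_smul, kronecker_smul]
  have hω := mix_posSemidef hc₁ hc₂ h₁ h₂
  have := relD_convex hc₁ hc₂ h₁ (one_kron_posSemidef (ptr_posSemidef h₁)) h₂
    (one_kron_posSemidef (ptr_posSemidef h₂)) hω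
    (by rw [e]; exact one_kron_posSemidef (ptr_posSemidef hω)) (suppLe_ptr h₁) (suppLe_ptr h₂)
    (by rw [e]; exact suppLe_ptr hω)
  rw [e, relD_ptr h₁, relD_ptr h₂, relD_ptr hω, ptr_mix] at this
  linarith

theorem card_pos_of_state {n : Type*} [Fintype n] {ρ : Matrix n n ℂ} (h : IsState ρ) :
    Nonempty n := by
  by_contra hn
  rw [not_nonempty_iff] at hn
  have := h.2
  simp [trace] at this

theorem cond_ge {a x : Type*} [Fintype a] [DecidableEq a] [Fintype x] [DecidableEq x]
    {ρ : Matrix (a × x) (a × x) ℂ} (h : IsState ρ) :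
    - Real.log (Fintype.card a) ≤ vnEntropy ρ - vnEntropy (ptr ρ) := by
  have hn : Nonempty a := (card_pos_of_state h).map Prod.fst
  have hd : 0 < (Fintype.card a : ℝ) := by exact_mod_cast Fintype.card_pos
  have hdc : (Fintype.card a : ℂ) ≠ 0 := by exact_mod_cast hd.ne'
  have hi : 0 < (Fintype.card a : ℝ)⁻¹ := inv_pos.2 hd
  have p : ((((Fintype.card a : ℝ)⁻¹ : ℝ) : ℂ) • ρ).PosSemidef :=
    h.1.smul (by exact_mod_cast hi.le)
  have := relD_anti (σ' := (1 : Matrix a a ℂ) ⊗ₖ ptr ρ) h.1 p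
    (one_kron_posSemidef (ptr_posSemidef h.1)) (by
      have h1 := (le_card_ptr h.1).smul (α := ℂ) (a := (((Fintype.card a : ℝ)⁻¹ : ℝ) : ℂ))
        (by exact_mod_cast hi.le)
      rw [smul_sub, smul_smul] at h1
      have e : (((Fintype.card a : ℝ)⁻¹ : ℝ) : ℂ) * (Fintype.card a : ℂ) = 1 := by
        push_cast
        exact inv_mul_cancel₀ hdc
      rwa [e, one_smul] at h1) (suppLe_smul_self ρ hi.ne')
  rw [relD_smul_self h.1.1 hi, relD_ptr h.1, h.2, Real.log_inv] at this
  simp at this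
  linarith

theorem cond_le {a x : Type*} [Fintype a] [DecidableEq a] [Fintype x] [DecidableEq x]
    {ρ : Matrix (a × x) (a × x) ℂ} (h : IsState ρ) :
    vnEntropy ρ - vnEntropy (ptr ρ) ≤ Real.log (Fintype.card a) := by
  have hn : Nonempty a := (card_pos_of_state h).map Prod.fst
  have hd : 0 < (Fintype.card a : ℝ) := by exact_mod_cast Fintype.card_pos
  have hσ := one_kron_posSemidef (a := a) (ptr_posSemidef h.1)
  have htr : trace ((1 : Matrix a a ℂ) ⊗ₖ ptr ρ) = Fintype.card a := by
    rw [trace_kronecker, ptr_trace, h.2]; simp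
  have tr1 : ∀ (A : Matrix (a × x) (a × x) ℂ) (c : ℂ), A.trace = c → ∀ Y : Matrix Unit Unit ℂ,
      trace ((c • (1 : Matrix Unit Unit ℂ)) * Y) =
        trace (A * (Y () () • (1 : Matrix (a × x) (a × x) ℂ))) := by
    intro A c hA Y
    rw [Matrix.mul_smul, mul_one, trace_smul, hA]
    simp [trace, mul_comm]
  have p1 : ((Fintype.card a : ℝ) : ℂ) • (1 : Matrix Unit Unit ℂ) |>.PosSemidef :=
    PosSemidef.one.smul (by exact_mod_cast hd.le)
  have := relD_dpi (ρ := ρ) (σ := (1 : Matrix a a ℂ) ⊗ₖ ptr ρ) (ρ' := (1 : Matrix Unit Unit ℂ))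
    (σ' := ((Fintype.card a : ℝ) : ℂ) • (1 : Matrix Unit Unit ℂ))
    (fun Y => Y () () • (1 : Matrix (a × x) (a × x) ℂ))
    (by intro X Y; simp [mul_apply, smul_smul, mul_comm]) (by intro X; simp [conjTranspose_smul])
    (by simp) h.1 hσ PosSemidef.one p1 (suppLe_ptr h.1) (suppLe_smul_self _ hd.ne')
    (by intro Y; have := tr1 ρ 1 h.2 Y; rwa [one_smul] at this)
    (by intro Y; exact tr1 _ _ (by rw [htr]; simp) Y)
  rw [relD_smul_self PosSemidef.one.1 hd, relD_ptr h.1] at this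
  simp at this
  linarith

theorem margBC_eq (ρ : Matrix (α × β × γ) (α × β × γ) ℂ) : margBC ρ = ptr ρ := rfl

theorem margC_eq (ρ : Matrix (α × β × γ) (α × β × γ) ℂ) : margC ρ = ptr (margAC ρ) := rfl

/-- The permutation of tensor factors. -/
def eAC (α β γ : Type*) : (α × β × γ) ≃ (β × α × γ) where
  toFun i := (i.2.1, i.1, i.2.2)
  invFun i := (i.2.1, i.1, i.2.2)
  left_inv _ := rfl
  right_inv _ := rfl

theorem margAC_eq (ρ : Matrix (α × β × γ) (α × β × γ) ℂ) :
    margAC ρ = ptr (ρ.submatrix (eAC α β γ).symm (eAC α β γ).symm) := rfl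

theorem margAC_posSemidef {ρ : Matrix (α × β × γ) (α × β × γ) ℂ} (h : ρ.PosSemidef) :
    (margAC ρ).PosSemidef := by
  rw [margAC_eq]
  exact ptr_posSemidef (h.submatrix _)

theorem margAC_trace_mul (ρ : Matrix (α × β × γ) (α × β × γ) ℂ)
    (Y : Matrix (α × γ) (α × γ) ℂ) :
    trace (margAC ρ * Y) =
      trace (ρ * ((1 : Matrix β β ℂ) ⊗ₖ Y).submatrix (eAC α β γ) (eAC α β γ)) := by
  rw [margAC_eq, ptr_trace_mul]
  have : ρ * ((1 : Matrix β β ℂ) ⊗ₖ Y).submatrix (eAC α β γ) (eAC α β γ) =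
    ((ρ.submatrix (eAC α β γ).symm (eAC α β γ).symm) * ((1 : Matrix β β ℂ) ⊗ₖ Y)).submatrix
      (eAC α β γ) (eAC α β γ) := by
    rw [← submatrix_mul_equiv _ _ _ (eAC α β γ)]
    simp
  rw [this]
  exact (Equiv.sum_comp (eAC α β γ) _).symm

theorem margAC_state {ρ : Matrix (α × β × γ) (α × β × γ) ℂ} (h : IsState ρ) :
    IsState (margAC ρ) := by
  refine ⟨margAC_posSemidef h.1, ?_⟩
  have := margAC_trace_mul ρ 1
  rw [mul_one] at this
  rw [this, one_kronecker_one, submatrix_one_equiv, mul_one, h.2]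

theorem ptr_state {a x : Type*} [Fintype a] [DecidableEq a] [Fintype x] [DecidableEq x]
    {ρ : Matrix (a × x) (a × x) ℂ} (h : IsState ρ) : IsState (ptr ρ) :=
  ⟨ptr_posSemidef h.1, by rw [ptr_trace, h.2]⟩

/-- Strong subadditivity. -/
theorem qcmi_nonneg {ρ : Matrix (α × β × γ) (α × β × γ) ℂ} (h : IsState ρ) : 0 ≤ qcmi ρ := by
  have hAC := margAC_state h
  have e : margAC ((1 : Matrix α α ℂ) ⊗ₖ ptr ρ) = (1 : Matrix α α ℂ) ⊗ₖ ptr (margAC ρ) := by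
    ext ⟨i, k⟩ ⟨j, l⟩
    show ∑ b : β, (1 : Matrix α α ℂ) i j * ∑ a : α, ρ (a, b, k) (a, b, l) =
      (1 : Matrix α α ℂ) i j * ∑ a : α, ∑ b : β, ρ (a, b, k) (a, b, l)
    rw [← Finset.mul_sum, Finset.sum_comm]
  have := relD_dpi (ρ := ρ) (σ := (1 : Matrix α α ℂ) ⊗ₖ ptr ρ) (ρ' := margAC ρ)
    (σ' := (1 : Matrix α α ℂ) ⊗ₖ ptr (margAC ρ))
    (fun Y => ((1 : Matrix β β ℂ) ⊗ₖ Y).submatrix (eAC α β γ) (eAC α β γ))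
    (by intro X Y; rw [submatrix_mul_equiv, ← mul_kronecker_mul, one_mul])
    (by intro X; rw [conjTranspose_submatrix, conjTranspose_kronecker]; simp)
    (by rw [one_kronecker_one, submatrix_one_equiv])
    h.1 (one_kron_posSemidef (ptr_posSemidef h.1)) hAC.1
    (one_kron_posSemidef (ptr_posSemidef hAC.1)) (suppLe_ptr h.1) (suppLe_ptr hAC.1)
    (margAC_trace_mul ρ) (by intro Y; rw [← e]; exact margAC_trace_mul _ Y)
  rw [relD_ptr h.1, relD_ptr hAC.1] at this
  rw [qcmi, margBC_eq, margC_eq]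
  linarith

theorem qcmi_le_A {ρ : Matrix (α × β × γ) (α × β × γ) ℂ} (h : IsState ρ) :
    qcmi ρ ≤ 2 * Real.log (Fintype.card α) := by
  have h1 := cond_ge h
  have h2 := cond_le (margAC_state h)
  rw [qcmi, margBC_eq, margC_eq]
  linarith

theorem vnEntropy_submatrix {n m : Type*} [Fintype n] [DecidableEq n] [Fintype m] [DecidableEq m]
    (e : m ≃ n) {A : Matrix n n ℂ} (h : A.IsHermitian) :
    vnEntropy (A.submatrix e e) = vnEntropy A := by
  have d := SpecDec.of_hermitian h
  have d' : SpecDec (A.submatrix e e) ((h.eigenvectorUnitary : Matrix n n ℂ).submatrix e e)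
      (fun i => h.eigenvalues (e i)) := by
    refine ⟨?_, ?_, ?_⟩
    · rw [conjTranspose_submatrix, submatrix_mul_equiv, d.left, submatrix_one_equiv]
    · rw [conjTranspose_submatrix, submatrix_mul_equiv, d.right, submatrix_one_equiv]
    · have : diagonal (fun i => (h.eigenvalues (e i) : ℂ)) =
          (diagonal (fun i => (h.eigenvalues i : ℂ))).submatrix e e := by
        rw [submatrix_diagonal_equiv]; rfl
      rw [this, conjTranspose_submatrix, submatrix_mul_equiv, submatrix_mul_equiv, ← d.eq]
  rw [d'.vnEntropy_eq, d.vnEntropy_eq]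
  exact Equiv.sum_comp e (fun i => Real.negMulLog (h.eigenvalues i))

theorem qcmi_le_B {ρ : Matrix (α × β × γ) (α × β × γ) ℂ} (h : IsState ρ) :
    qcmi ρ ≤ 2 * Real.log (Fintype.card β) := by
  have hs : IsState (ρ.submatrix (eAC α β γ).symm (eAC α β γ).symm) := by
    refine ⟨h.1.submatrix _, ?_⟩
    rw [← h.2]
    exact Equiv.sum_comp (eAC α β γ).symm (fun i => ρ i i)
  have := qcmi_le_A hs
  have e1 : margAC (ρ.submatrix (eAC α β γ).symm (eAC α β γ).symm) = margBC ρ := rfl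
  have e2 : margBC (ρ.submatrix (eAC α β γ).symm (eAC α β γ).symm) = margAC ρ := rfl
  have e3 : margC (ρ.submatrix (eAC α β γ).symm (eAC α β γ).symm) = margC ρ := by
    ext i j
    exact Finset.sum_comm
  rw [qcmi, e1, e2, e3, vnEntropy_submatrix _ h.1.1] at this
  rw [qcmi]
  linarith

theorem margAC_mix (ρ₁ ρ₂ : Matrix (α × β × γ) (α × β × γ) ℂ) (c₁ c₂ : ℂ) :
    margAC (c₁ • ρ₁ + c₂ • ρ₂) = c₁ • margAC ρ₁ + c₂ • margAC ρ₂ := by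
  ext i j
  simp [margAC, Finset.sum_add_distrib, Finset.mul_sum]

/-- Almost convexity. -/
theorem qcmi_almost {ρ₁ ρ₂ : Matrix (α × β × γ) (α × β × γ) ℂ} {c₁ c₂ : ℝ}
    (hc₁ : 0 < c₁) (hc₂ : 0 < c₂) (hc : c₁ + c₂ = 1) (h₁ : IsState ρ₁) (h₂ : IsState ρ₂) :
    |c₁ * qcmi ρ₁ + c₂ * qcmi ρ₂ - qcmi ((c₁ : ℂ) • ρ₁ + (c₂ : ℂ) • ρ₂)| ≤
      Real.negMulLog c₁ + Real.negMulLog c₂ := by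
  have a₁ := margAC_state h₁
  have a₂ := margAC_state h₂
  have b₁ := ptr_state h₁
  have b₂ := ptr_state h₂
  have k₁ := ptr_state a₁
  have k₂ := ptr_state a₂
  have i1 := cond_concave hc₁.le hc₂.le h₁.1 h₂.1
  have i2 := cond_concave hc₁.le hc₂.le a₁.1 a₂.1
  have i3 := entropy_mix_le hc₁ hc₂ h₁ h₂
  have i4 := entropy_mix_le hc₁ hc₂ a₁ a₂
  have i5 := entropy_concave hc₁.le hc₂.le hc b₁.1 b₂.1
  have i6 := entropy_concave hc₁.le hc₂.le hc k₁.1 k₂.1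
  simp only [qcmi, margBC_eq, margC_eq, margAC_mix, ptr_mix]
  rw [abs_le]
  constructor <;> linarith

/-- Jordan decomposition with the traces controlled by the trace norm. -/
theorem jordan {n : Type*} [Fintype n] [DecidableEq n] {M : Matrix n n ℂ} (hM : M.IsHermitian)
    (htr : M.trace = 0) : ∃ P N : Matrix n n ℂ, P.PosSemidef ∧ N.PosSemidef ∧ M = P - N ∧
      P.trace = ((traceNorm M / 2 : ℝ) : ℂ) ∧ N.trace = ((traceNorm M / 2 : ℝ) : ℂ) := by
  have d := SpecDec.of_hermitian hM
  generalize (hM.eigenvectorUnitary : Matrix n n ℂ) = U at d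
  generalize hM.eigenvalues = l at d
  have dsq : SpecDec (Mᴴ * M) U (fun i => l i ^ 2) := by
    refine ⟨d.left, d.right, ?_⟩
    rw [hM.eq]
    conv_lhs => rw [d.eq]
    calc _ = U * diagonal (fun i => (l i : ℂ)) * (Uᴴ * U) * diagonal (fun i => (l i : ℂ)) * Uᴴ := by
          simp only [mul_assoc]
      _ = U * (diagonal (fun i => (l i : ℂ)) * diagonal (fun i => (l i : ℂ))) * Uᴴ := by
          rw [d.left]; simp only [mul_assoc, mul_one]
      _ = _ := by
          rw [diagonal_mul_diagonal]
          congr 3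
          ext i
          push_cast
          ring
  have tn : traceNorm M = ∑ i, |l i| := by
    rw [traceNorm, dsq.sum_eq]
    simp only [Real.sqrt_sq_eq_abs]
  have dP : SpecDec (U * diagonal (fun i => ((max (l i) 0 : ℝ) : ℂ)) * Uᴴ) U
    (fun i => max (l i) 0) := ⟨d.left, d.right, rfl⟩
  have dN : SpecDec (U * diagonal (fun i => ((max (-l i) 0 : ℝ) : ℂ)) * Uᴴ) U
    (fun i => max (-l i) 0) := ⟨d.left, d.right, rfl⟩
  have s0 : ∑ i, l i = 0 := by
    have := d.trace_eq
    rw [htr] at this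
    exact_mod_cast this.symm
  refine ⟨_, _, dP.posSemidef fun i => le_max_right _ _, dN.posSemidef fun i => le_max_right _ _,
    ?_, ?_, ?_⟩
  · rw [← sub_mul, ← mul_sub, diagonal_sub]
    conv_lhs => rw [d.eq]
    congr 3
    ext i
    rw [← Complex.ofReal_sub]
    congr 1
    rcases le_total (l i) 0 with h | h
    · rw [max_eq_right h, max_eq_left (by linarith)]; ring
    · rw [max_eq_left h, max_eq_right (by linarith)]; ring
  · rw [dP.trace_eq, tn]
    congr 1
    have : ∑ i, max (l i) 0 = ∑ i, (|l i| / 2 + l i / 2) := by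
      refine Finset.sum_congr rfl fun i _ => ?_
      rcases le_total (l i) 0 with h | h
      · rw [max_eq_right h, abs_of_nonpos h]; ring
      · rw [max_eq_left h, abs_of_nonneg h]; ring
    rw [this, Finset.sum_add_distrib, ← Finset.sum_div, ← Finset.sum_div, s0]
    ring
  · rw [dN.trace_eq, tn]
    congr 1
    have : ∑ i, max (-l i) 0 = ∑ i, (|l i| / 2 - l i / 2) := by
      refine Finset.sum_congr rfl fun i _ => ?_
      rcases le_total (l i) 0 with h | h
      · rw [max_eq_left (by linarith), abs_of_nonpos h]; ring
      · rw [max_eq_right (by linarith), abs_of_nonneg h]; ring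
    rw [this, Finset.sum_sub_distrib, ← Finset.sum_div, ← Finset.sum_div, s0]
    ring

theorem qcmi_le_min {ρ : Matrix (α × β × γ) (α × β × γ) ℂ} (h : IsState ρ) :
    qcmi ρ ≤ 2 * Real.log (min (Fintype.card α) (Fintype.card β)) := by
  rcases le_total (Fintype.card α : ℝ) (Fintype.card β : ℝ) with hl | hl
  · rw [min_eq_left hl]; exact qcmi_le_A h
  · rw [min_eq_right hl]; exact qcmi_le_B h

theorem gFun_eq {ε : ℝ} (h : 0 < ε) :
    (1 + ε) * (Real.negMulLog (1 / (1 + ε)) + Real.negMulLog (ε / (1 + ε))) = gFun ε := by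
  have h1 : 0 < 1 + ε := by linarith
  rw [Real.negMulLog, Real.negMulLog, gFun, Real.log_div one_ne_zero h1.ne',
    Real.log_div h.ne' h1.ne', Real.log_one]
  field_simp
  ring

theorem qcmi_fannes_continuity_bound (ρ σ : Matrix (α × β × γ) (α × β × γ) ℂ)
    (hρ : IsState ρ) (hσ : IsState σ) (ε : ℝ) (hε : ε = traceNorm (ρ - σ) / 2) :
    |qcmi ρ - qcmi σ| ≤
      2 * ε * Real.log (min (Fintype.card α) (Fintype.card β)) + 2 * gFun ε := by
  have hH : (ρ - σ).IsHermitian := hρ.1.1.sub hσ.1.1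
  obtain ⟨P, N, hP, hN, hPN, tP, tN⟩ := jordan hH (by rw [trace_sub, hρ.2, hσ.2, sub_self])
  rw [← hε] at tP tN
  have hε0 : 0 ≤ ε := by
    have := hP.trace_nonneg
    rw [tP] at this
    exact_mod_cast this
  rcases hε0.eq_or_lt with h0 | hpos
  · subst h0
    have p0 : P = 0 := hP.trace_eq_zero_iff.1 (by rw [tP]; simp)
    have n0 : N = 0 := hN.trace_eq_zero_iff.1 (by rw [tN]; simp)
    rw [p0, n0, sub_self, sub_eq_zero] at hPN
    rw [hPN]
    simp [gFun]
  · have h1 : 0 < 1 + ε := by linarith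
    have hεc : (ε : ℂ) ≠ 0 := by exact_mod_cast hpos.ne'
    have h1c : (1 + ε : ℂ) ≠ 0 := by exact_mod_cast h1.ne'
    have hi : (0 : ℂ) ≤ ((ε⁻¹ : ℝ) : ℂ) := by exact_mod_cast (inv_pos.2 hpos).le
    have sP : IsState (((ε⁻¹ : ℝ) : ℂ) • P) := by
      refine ⟨hP.smul hi, ?_⟩
      rw [trace_smul, tP, smul_eq_mul, ← Complex.ofReal_mul, inv_mul_cancel₀ hpos.ne']
      simp
    have sN : IsState (((ε⁻¹ : ℝ) : ℂ) • N) := by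
      refine ⟨hN.smul hi, ?_⟩
      rw [trace_smul, tN, smul_eq_mul, ← Complex.ofReal_mul, inv_mul_cancel₀ hpos.ne']
      simp
    have c1 : 0 < 1 / (1 + ε) := by positivity
    have c2 : 0 < ε / (1 + ε) := by positivity
    have c12 : 1 / (1 + ε) + ε / (1 + ε) = 1 := by field_simp
    have a1 := qcmi_almost c1 c2 c12 hρ sN
    have a2 := qcmi_almost c1 c2 c12 hσ sP
    have e : ((1 / (1 + ε) : ℝ) : ℂ) • ρ + ((ε / (1 + ε) : ℝ) : ℂ) • (((ε⁻¹ : ℝ) : ℂ) • N) =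
        ((1 / (1 + ε) : ℝ) : ℂ) • σ + ((ε / (1 + ε) : ℝ) : ℂ) • (((ε⁻¹ : ℝ) : ℂ) • P) := by
      have h2 : ((ε / (1 + ε) : ℝ) : ℂ) * ((ε⁻¹ : ℝ) : ℂ) = ((1 / (1 + ε) : ℝ) : ℂ) := by
        rw [← Complex.ofReal_mul]
        congr 1
        field_simp
      rw [smul_smul, smul_smul, h2, ← smul_add, ← smul_add]
      congr 1
      have : ρ = σ + (P - N) := by rw [← hPN]; abel
      rw [this]; abel
    rw [e] at a1
    have nP := qcmi_nonneg sP
    have nN := qcmi_nonneg sN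
    have uP := qcmi_le_min sP
    have uN := qcmi_le_min sN
    have hg := gFun_eq hpos
    set h := Real.negMulLog (1 / (1 + ε)) + Real.negMulLog (ε / (1 + ε)) with hh
    set D := Real.log (min (Fintype.card α) (Fintype.card β)) with hD
    generalize qcmi (((1 / (1 + ε) : ℝ) : ℂ) • σ +
      ((ε / (1 + ε) : ℝ) : ℂ) • (((ε⁻¹ : ℝ) : ℂ) • P)) = W at a1 a2
    generalize qcmi (((ε⁻¹ : ℝ) : ℂ) • P) = IP at *
    generalize qcmi (((ε⁻¹ : ℝ) : ℂ) • N) = IN at *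
    generalize qcmi ρ = Iρ at *
    generalize qcmi σ = Iσ at *
    have key : |(Iρ - Iσ) + ε * (IN - IP)| ≤ 2 * gFun ε := by
      have h3 : (Iρ - Iσ) + ε * (IN - IP) =
          (1 + ε) * ((1 / (1 + ε) * Iρ + ε / (1 + ε) * IN - W) -
            (1 / (1 + ε) * Iσ + ε / (1 + ε) * IP - W)) := by
        field_simp
        ring
      rw [h3, abs_mul, abs_of_pos h1, ← hg]
      have := mul_le_mul_of_nonneg_left ((abs_sub _ _).trans (add_le_add a1 a2)) h1.le
      linarith
    have k1 : ε * (IN - IP) ≤ ε * (2 * D) := mul_le_mul_of_nonneg_left (by linarith) hε0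
    have k2 : ε * (IP - IN) ≤ ε * (2 * D) := mul_le_mul_of_nonneg_left (by linarith) hε0
    rw [abs_le] at key ⊢
    constructor <;> nlinarith [key.1, key.2]
end
end

section
/- If {pᵢ} = {qᵢ} (equal probability distributions), then for ensembles {pᵢ, ρᵢ} and {pᵢ, σᵢ} of states on a finite-dimensional space, |χ({pᵢ,ρᵢ}) − χ({pᵢ,σᵢ})| ≤ ε·log m + g(ε), where ε = (1/2)·Σᵢ pᵢ‖ρᵢ − σᵢ‖₁ is the average trace-norm distance and m is the number of states in the ensembles. -/
set_option maxHeartbeats 1000000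

open Matrix Real
open scoped ComplexOrder

noncomputable section

/-- The Holevo quantity χ({pᵢ,ρᵢ}) = H(Σᵢ pᵢρᵢ) − Σᵢ pᵢ H(ρᵢ). -/
def holevo {ι n : Type*} [Fintype ι] [Fintype n] [DecidableEq n]
    (p : ι → ℝ) (ρ : ι → Matrix n n ℂ) : ℝ :=
  vnEntropy (∑ i, p i • ρ i) - ∑ i, p i * vnEntropy (ρ i)

namespace HolevoAux

variable {n : Type*} [Fintype n] [DecidableEq n]

lemma spec {A : Matrix n n ℂ} (hA : A.IsHermitian) :
    ∃ U : Matrix n n ℂ, Uᴴ * U = 1 ∧ U * Uᴴ = 1 ∧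
      A = U * diagonal (fun i => (hA.eigenvalues i : ℂ)) * Uᴴ := by
  refine ⟨hA.eigenvectorUnitary, ?_, ?_, ?_⟩
  · exact Unitary.coe_star_mul_self hA.eigenvectorUnitary
  · exact Unitary.coe_mul_star_self hA.eigenvectorUnitary
  · have := hA.spectral_theorem
    rw [Unitary.conjStarAlgAut_apply] at this
    exact this

lemma eigsum {A U : Matrix n n ℂ} (hA : A.IsHermitian) (hU : Uᴴ * U = 1) (d : n → ℝ)
    (h : A = U * diagonal (fun i => (d i : ℂ)) * Uᴴ) (f : ℝ → ℝ) :
    ∑ i, f (hA.eigenvalues i) = ∑ i, f (d i) := by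
  have h1 : A.charpoly = ∏ i, (Polynomial.X - Polynomial.C (d i : ℂ)) := by
    rw [h, charpoly_mul_comm, ← mul_assoc, hU, one_mul, charpoly_diagonal]
  have h2 := hA.roots_charpoly_eq_eigenvalues
  rw [h1, Polynomial.roots_prod _ _ (Finset.prod_ne_zero_iff.2 fun i _ => Polynomial.X_sub_C_ne_zero _)] at h2
  simp only [Polynomial.roots_X_sub_C, Multiset.bind_singleton] at h2
  have h3 := congrArg (fun s => ((s.map Complex.re).map f).sum) h2
  simp only [Multiset.map_map, Function.comp_def, Complex.ofReal_re] at h3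
  exact h3.symm

lemma det_conj {U D : Matrix n n ℂ} (hU : Uᴴ * U = 1) :
    (U * D * Uᴴ).det = D.det := by
  rw [det_mul_comm, ← mul_assoc, hU, one_mul]

lemma det_shift {A : Matrix n n ℂ} (hA : A.IsHermitian) (s : ℝ) :
    ((s : ℂ) • (1 : Matrix n n ℂ) + A).det = ((∏ i, (hA.eigenvalues i + s) : ℝ) : ℂ) := by
  obtain ⟨U, h1, h2, h3⟩ := spec hA
  have : (s : ℂ) • (1 : Matrix n n ℂ) + A =
      U * diagonal (fun i => ((hA.eigenvalues i + s : ℝ) : ℂ)) * Uᴴ := by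
    have e : diagonal (fun i => ((hA.eigenvalues i + s : ℝ) : ℂ)) =
      (s : ℂ) • (1 : Matrix n n ℂ) + diagonal (fun i => (hA.eigenvalues i : ℂ)) := by
      ext i j
      by_cases h : i = j
      · subst h; simp [add_comm]
      · simp [h]
    rw [e, mul_add, add_mul, ← h3]
    simp [h2]
  rw [this, det_conj h1, det_diagonal]
  push_cast; rfl

lemma psd_diag {U : Matrix n n ℂ} {d : n → ℝ} (hd : ∀ i, 0 ≤ d i) :
    (U * diagonal (fun i => (d i : ℂ)) * Uᴴ).PosSemidef := by
  apply PosSemidef.mul_mul_conjTranspose_same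
  apply PosSemidef.diagonal
  intro i
  simpa using hd i

lemma psd_factor {A : Matrix n n ℂ} (hA : A.PosSemidef) : ∃ B : Matrix n n ℂ, A = Bᴴ * B := by
  obtain ⟨U, h1, h2, h3⟩ := spec hA.1
  refine ⟨diagonal (fun i => ((Real.sqrt (hA.1.eigenvalues i) : ℝ) : ℂ)) * Uᴴ, ?_⟩
  rw [conjTranspose_mul, conjTranspose_conjTranspose, diagonal_conjTranspose]
  conv_lhs => rw [h3]
  rw [mul_assoc, mul_assoc, ← mul_assoc (diagonal _) (diagonal _), diagonal_mul_diagonal]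
  congr 3
  ext i
  simp only [Pi.star_apply, Complex.star_def, Complex.conj_ofReal]
  rw [← Complex.ofReal_mul, Real.mul_self_sqrt (hA.eigenvalues_nonneg i)]

lemma det_add {X : Matrix n n ℂ} (hX : X.PosDef) :
    ∃ D : Matrix n n ℂ, D * Dᴴ = X⁻¹ ∧ ∀ M, (X + M).det = X.det * (1 + Dᴴ * M * D).det := by
  obtain ⟨C, hC⟩ := psd_factor hX.posSemidef
  have hu : IsUnit C.det := by
    have h : X.det ≠ 0 := hX.det_pos.ne'
    rw [hC, det_mul] at h
    exact isUnit_iff_ne_zero.2 (right_ne_zero_of_mul h)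
  have hu' : IsUnit Cᴴ.det := by rw [det_conjTranspose]; exact hu.star
  have e1 : C⁻¹ * C = 1 := nonsing_inv_mul _ hu
  have e2 : Cᴴ * C⁻¹ᴴ = 1 := by rw [← conjTranspose_mul, e1, conjTranspose_one]
  refine ⟨C⁻¹, ?_, fun M => ?_⟩
  · rw [hC, Matrix.mul_inv_rev, conjTranspose_nonsing_inv]
  · have : X + M = Cᴴ * (1 + C⁻¹ᴴ * M * C⁻¹) * C := by
      rw [mul_add, add_mul, mul_one, ← hC, ← mul_assoc, ← mul_assoc, e2, one_mul, mul_assoc, e1, mul_one]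
    rw [this, hC]
    simp only [det_mul]; ring

lemma one_le_det {Q : Matrix n n ℂ} (hQ : Q.PosSemidef) :
    ∃ r : ℝ, 1 ≤ r ∧ (1 + Q).det = r := by
  have := det_shift hQ.1 1
  simp only [Complex.ofReal_one, one_smul] at this
  refine ⟨_, ?_, this⟩
  have h1 : ∏ _i : n, (1 : ℝ) ≤ ∏ i, (hQ.1.eigenvalues i + 1) := by
    refine Finset.prod_le_prod (fun _ _ => zero_le_one) fun i _ => ?_
    linarith [hQ.eigenvalues_nonneg i]
  simpa using h1

lemma det_mono {P Q : Matrix n n ℂ} (hP : P.PosSemidef) (hQ : Q.PosSemidef) :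
    (1 + P).det.re ≤ (1 + P + Q).det.re := by
  have hX : (1 + P).PosDef := PosDef.one.add_posSemidef hP
  obtain ⟨D, -, h⟩ := det_add hX
  obtain ⟨r, hr, h1⟩ := one_le_det (hQ.conjTranspose_mul_mul_same D)
  obtain ⟨t, ht, h2⟩ := one_le_det hP
  rw [h, h1, h2, ← Complex.ofReal_mul, Complex.ofReal_re, Complex.ofReal_re]
  nlinarith

lemma det_submod_one {M N : Matrix n n ℂ} (hM : M.PosSemidef) (hN : N.PosSemidef) :
    (1 + M + N).det.re ≤ (1 + M).det.re * (1 + N).det.re := by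
  have hX : (1 + M).PosDef := PosDef.one.add_posSemidef hM
  obtain ⟨D, hD, h⟩ := det_add hX
  obtain ⟨B, hB⟩ := psd_factor hN
  obtain ⟨t, ht, h2⟩ := one_le_det hM
  have e1 : (1 + Dᴴ * N * D).det = (1 + B * (1 + M)⁻¹ * Bᴴ).det := by
    rw [← hD, hB]
    have : Dᴴ * (Bᴴ * B) * D = (Dᴴ * Bᴴ) * (B * D) := by simp only [mul_assoc]
    rw [this, det_one_add_mul_comm]
    simp only [mul_assoc]
  have e2 : (1 + N).det = (1 + B * Bᴴ).det := by rw [hB, det_one_add_mul_comm]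
  have hu : IsUnit (1 + M).det := isUnit_iff_ne_zero.2 hX.det_pos.ne'
  have hY1 : (1 + M)⁻¹ * (1 + M) = 1 := nonsing_inv_mul _ hu
  have hY2 : (1 + M) * (1 + M)⁻¹ = 1 := mul_nonsing_inv _ hu
  have hYH : ((1 + M)⁻¹)ᴴ = (1 + M)⁻¹ := hX.inv.1
  have e3 : 1 - (1 + M)⁻¹ = ((1 + M)⁻¹)ᴴ * (M + Mᴴ * M) * (1 + M)⁻¹ := by
    rw [hYH, hM.1.eq]
    have : M + M * M = (1 + M) * (1 + M) - (1 + M) := by noncomm_ring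
    rw [this, mul_sub, ← mul_assoc, hY1, one_mul, sub_mul, hY2, one_mul]
  have hR : (1 - (1 + M)⁻¹).PosSemidef := by
    rw [e3]
    exact (hM.add (posSemidef_conjTranspose_mul_self M)).conjTranspose_mul_mul_same _
  have hm := det_mono (hX.inv.posSemidef.mul_mul_conjTranspose_same B)
    (hR.mul_mul_conjTranspose_same B)
  have e4 : 1 + B * (1 + M)⁻¹ * Bᴴ + B * (1 - (1 + M)⁻¹) * Bᴴ = 1 + B * Bᴴ := by
    noncomm_ring
  rw [e4, ← e1, ← e2] at hm
  rw [h, h2, Complex.re_ofReal_mul, Complex.ofReal_re]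
  exact mul_le_mul_of_nonneg_left hm (by linarith)

lemma det_submod {X M N : Matrix n n ℂ} (hX : X.PosDef) (hM : M.PosSemidef)
    (hN : N.PosSemidef) :
    (X + M + N).det.re * X.det.re ≤ (X + M).det.re * (X + N).det.re := by
  obtain ⟨D, -, h⟩ := det_add hX
  have h0 := hX.det_pos
  obtain ⟨x, hx⟩ : ∃ x : ℝ, X.det = x := ⟨X.det.re, by
    apply Complex.ext <;> simp [← (Complex.lt_def.1 h0).2]⟩
  have h1 := det_submod_one (hM.conjTranspose_mul_mul_same D) (hN.conjTranspose_mul_mul_same D)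
  have : 1 + Dᴴ * M * D + Dᴴ * N * D = 1 + Dᴴ * (M + N) * D := by noncomm_ring
  rw [this] at h1
  rw [add_assoc, h, h, h, hx]
  simp only [Complex.re_ofReal_mul, Complex.ofReal_re]
  nlinarith [mul_le_mul_of_nonneg_left h1 (mul_self_nonneg x)]

lemma vn_eq {A : Matrix n n ℂ} (hA : A.IsHermitian) :
    vnEntropy A = ∑ i, Real.negMulLog (hA.eigenvalues i) := by
  rw [vnEntropy, dif_pos hA]

lemma trace_re {A : Matrix n n ℂ} (hA : A.IsHermitian) :
    A.trace.re = ∑ i, hA.eigenvalues i := by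
  rw [hA.trace_eq_sum_eigenvalues]; simp

/-- Shifted `x log x` trace functional. -/
def shiftT {A : Matrix n n ℂ} (hA : A.IsHermitian) (S : ℝ) : ℝ :=
  ∑ i, (hA.eigenvalues i + S) * Real.log (hA.eigenvalues i + S)

lemma shiftT_zero {A : Matrix n n ℂ} (hA : A.IsHermitian) : shiftT hA 0 = - vnEntropy A := by
  rw [vn_eq hA, shiftT, ← Finset.sum_neg_distrib]
  simp [Real.negMulLog]

lemma shiftT_cont {A : Matrix n n ℂ} (hA : A.IsHermitian) : Continuous (shiftT hA) := by
  unfold shiftT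
  refine continuous_finsetSum _ fun i _ => ?_
  exact Real.continuous_mul_log.comp (continuous_const.add continuous_id)

lemma shiftT_deriv {A : Matrix n n ℂ} (hA : A.PosSemidef) {S : ℝ} (hS : 0 < S) :
    HasDerivAt (shiftT hA.1)
      (Real.log ((S : ℂ) • (1 : Matrix n n ℂ) + A).det.re + Fintype.card n) S := by
  have hp : ∀ i, 0 < hA.1.eigenvalues i + S := fun i => by
    linarith [hA.eigenvalues_nonneg i]
  have e : Real.log ((S : ℂ) • (1 : Matrix n n ℂ) + A).det.re + Fintype.card n
      = ∑ i, (Real.log (hA.1.eigenvalues i + S) + 1) := by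
    rw [det_shift hA.1, Complex.ofReal_re, Real.log_prod (fun i _ => (hp i).ne'),
      Finset.sum_add_distrib]
    simp
  rw [e]
  unfold shiftT
  refine HasDerivAt.fun_sum fun i _ => ?_
  have h1 := (Real.hasDerivAt_mul_log (hp i).ne').comp_const_add (hA.1.eigenvalues i) S
  exact h1

lemma shiftT_lower {A : Matrix n n ℂ} (hA : A.PosSemidef) {S : ℝ} (hS : 0 < S) :
    (A.trace.re + Fintype.card n * S) * Real.log S + A.trace.re ≤ shiftT hA.1 S := by
  have e : (A.trace.re + Fintype.card n * S) * Real.log S + A.trace.re =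
      ∑ i, ((hA.1.eigenvalues i + S) * Real.log S + hA.1.eigenvalues i) := by
    rw [Finset.sum_add_distrib, ← Finset.sum_mul, Finset.sum_add_distrib, trace_re hA.1]
    simp
  rw [e]
  refine Finset.sum_le_sum fun i _ => ?_
  have h0 := hA.eigenvalues_nonneg i
  set l := hA.1.eigenvalues i
  have h1 : 0 < l + S := by linarith
  have h2 := Real.log_le_sub_one_of_pos (div_pos hS h1)
  rw [Real.log_div hS.ne' h1.ne'] at h2
  have h3 := mul_le_mul_of_nonneg_left h2 h1.le
  have h4 : (l + S) * (S / (l + S) - 1) = - l := by field_simp; ring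
  rw [h4] at h3
  linarith

lemma shiftT_upper {A : Matrix n n ℂ} (hA : A.PosSemidef) {S : ℝ} (hS : 0 < S) :
    shiftT hA.1 S ≤ (A.trace.re + Fintype.card n * S) * Real.log S + A.trace.re
      + (∑ i, hA.1.eigenvalues i ^ 2) / S := by
  have e : (A.trace.re + Fintype.card n * S) * Real.log S + A.trace.re
      + (∑ i, hA.1.eigenvalues i ^ 2) / S =
      ∑ i, ((hA.1.eigenvalues i + S) * Real.log S + hA.1.eigenvalues i
        + hA.1.eigenvalues i ^ 2 / S) := by
    rw [Finset.sum_add_distrib, Finset.sum_add_distrib, ← Finset.sum_mul,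
      Finset.sum_add_distrib, trace_re hA.1, Finset.sum_div]
    simp
  rw [e]
  refine Finset.sum_le_sum fun i _ => ?_
  have h0 := hA.eigenvalues_nonneg i
  set l := hA.1.eigenvalues i
  have h1 : 0 < l + S := by linarith
  have h2 := Real.log_le_sub_one_of_pos (div_pos h1 hS)
  rw [Real.log_div h1.ne' hS.ne'] at h2
  have h3 := mul_le_mul_of_nonneg_left h2 h1.le
  have h4 : (l + S) * ((l + S) / S - 1) = l + l ^ 2 / S := by field_simp; ring
  rw [h4] at h3
  linarith

lemma vn_submod {A M N : Matrix n n ℂ} (hA : A.PosSemidef) (hM : M.PosSemidef)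
    (hN : N.PosSemidef) :
    vnEntropy (A + M + N) + vnEntropy A ≤ vnEntropy (A + M) + vnEntropy (A + N) := by
  have hAM := hA.add hM
  have hAN := hA.add hN
  have hAMN := hAM.add hN
  let φ : ℝ → ℝ := fun S => shiftT hAMN.1 S - shiftT hAM.1 S - shiftT hAN.1 S + shiftT hA.1 S
  have hc : Continuous φ := (((shiftT_cont _).sub (shiftT_cont _)).sub (shiftT_cont _)).add
    (shiftT_cont _)
  have hanti : AntitoneOn φ (Set.Ici 0) := by
    have hd : ∀ S : ℝ, 0 < S → HasDerivAt φ _ S := fun S hS =>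
      (((shiftT_deriv hAMN hS).sub (shiftT_deriv hAM hS)).sub (shiftT_deriv hAN hS)).add
        (shiftT_deriv hA hS)
    refine antitoneOn_of_deriv_nonpos (convex_Ici 0) hc.continuousOn ?_ ?_
    · intro S hS
      rw [interior_Ici] at hS
      exact (hd S hS).differentiableAt.differentiableWithinAt
    · intro S hS
      rw [interior_Ici] at hS
      rw [(hd S hS).deriv]
      have hS : 0 < S := hS
      have hX : ((S : ℂ) • (1 : Matrix n n ℂ) + A).PosDef :=
        (PosDef.one.smul (by simpa using hS)).add_posSemidef hA
      have h1 := det_submod hX hM hN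
      have pos : ∀ {B : Matrix n n ℂ}, B.PosSemidef →
          0 < ((S : ℂ) • (1 : Matrix n n ℂ) + B).det.re := fun {B} hB => by
        rw [det_shift hB.1, Complex.ofReal_re]
        exact Finset.prod_pos fun i _ => by linarith [hB.eigenvalues_nonneg i]
      rw [add_assoc _ A M, add_assoc _ (A + M) N, add_assoc _ A N] at h1
      have h2 := Real.log_le_log (mul_pos (pos hAMN) (pos hA)) h1
      rw [Real.log_mul (pos hAMN).ne' (pos hA).ne', Real.log_mul (pos hAM).ne' (pos hAN).ne'] at h2
      linarith
  have hb : ∀ S : ℝ, 0 < S → -((∑ i, hAM.1.eigenvalues i ^ 2) + ∑ i, hAN.1.eigenvalues i ^ 2) / S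
      ≤ φ 0 := by
    intro S hS
    refine le_trans ?_ (hanti (Set.mem_Ici.2 le_rfl) (Set.mem_Ici.2 hS.le) hS.le)
    have h1 := shiftT_lower hAMN hS
    have h2 := shiftT_lower hA hS
    have h3 := shiftT_upper hAM hS
    have h4 := shiftT_upper hAN hS
    simp only [trace_add, Complex.add_re] at h1 h2 h3 h4
    rw [neg_div, add_div]
    simp only [φ]
    nlinarith
  have h0 : 0 ≤ φ 0 := by
    refine le_of_tendsto (x := Filter.atTop) (Filter.Tendsto.const_div_atTop Filter.tendsto_id
      (-((∑ i, hAM.1.eigenvalues i ^ 2) + ∑ i, hAN.1.eigenvalues i ^ 2))) ?_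
    filter_upwards [Filter.eventually_gt_atTop (0 : ℝ)] with S hS
    exact hb S hS
  simp only [φ, shiftT_zero] at h0
  linarith

lemma vn_zero : vnEntropy (0 : Matrix n n ℂ) = 0 := by
  have h : (0 : Matrix n n ℂ).IsHermitian := isHermitian_zero
  rw [vn_eq h, eigsum h (U := 1) (by simp) (fun _ => 0) (by ext i j; simp [diagonal_apply])]
  simp

lemma vn_smul {A : Matrix n n ℂ} (hA : A.IsHermitian) (c : ℝ) :
    vnEntropy (c • A) = c * vnEntropy A + A.trace.re * Real.negMulLog c := by
  obtain ⟨U, h1, h2, h3⟩ := spec hA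
  have hc : (c • A).IsHermitian := by
    rw [IsHermitian, conjTranspose_smul, hA.eq]; simp
  have e : c • A = U * diagonal (fun i => ((c * hA.eigenvalues i : ℝ) : ℂ)) * Uᴴ := by
    have : diagonal (fun i => ((c * hA.eigenvalues i : ℝ) : ℂ)) =
        c • diagonal (fun i => (hA.eigenvalues i : ℂ)) := by
      ext i j
      by_cases h : i = j
      · subst h; simp
      · simp [h]
    rw [this, mul_smul_comm, smul_mul_assoc, ← h3]
  rw [vn_eq hc, eigsum hc h1 _ e, vn_eq hA, trace_re hA, Finset.sum_mul, Finset.mul_sum,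
    ← Finset.sum_add_distrib]
  refine Finset.sum_congr rfl fun i _ => ?_
  rw [Real.negMulLog_mul]; ring

/-- Peierls-type inequality. -/
lemma peierls {A V : Matrix n n ℂ} (hA : A.PosSemidef) (hV1 : Vᴴ * V = 1) (hV2 : V * Vᴴ = 1) :
    vnEntropy A ≤ ∑ k, Real.negMulLog ((Vᴴ * A * V) k k).re := by
  obtain ⟨U, h1, h2, h3⟩ := spec hA.1
  set W := Vᴴ * U with hW
  have hW1 : Wᴴ * W = 1 := by
    rw [hW, conjTranspose_mul, conjTranspose_conjTranspose, mul_assoc, ← mul_assoc V, hV2, one_mul, h1]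
  have hW2 : W * Wᴴ = 1 := by
    rw [hW, conjTranspose_mul, conjTranspose_conjTranspose, mul_assoc, ← mul_assoc U, h2, one_mul, hV1]
  have e : Vᴴ * A * V = W * diagonal (fun i => (hA.1.eigenvalues i : ℂ)) * Wᴴ := by
    conv_lhs => rw [h3]
    rw [hW, conjTranspose_mul, conjTranspose_conjTranspose]
    simp only [mul_assoc]
  have ek : ∀ k, ((Vᴴ * A * V) k k).re = ∑ j, Complex.normSq (W k j) * hA.1.eigenvalues j := by
    intro k
    rw [e, mul_apply, Complex.re_sum]
    refine Finset.sum_congr rfl fun j _ => ?_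
    rw [mul_diagonal, conjTranspose_apply]
    generalize hA.1.eigenvalues j = l
    generalize W k j = w
    rw [Complex.star_def, mul_right_comm, Complex.mul_conj, ← Complex.ofReal_mul,
      Complex.ofReal_re]
  have r1 : ∀ k, ∑ j, Complex.normSq (W k j) = 1 := by
    intro k
    have := congrArg Complex.re (congrFun (congrFun hW2 k) k)
    rw [mul_apply, Complex.re_sum, one_apply_eq, Complex.one_re] at this
    rw [← this]
    refine Finset.sum_congr rfl fun j _ => ?_
    rw [conjTranspose_apply, Complex.star_def, Complex.mul_conj, Complex.ofReal_re]
  have r2 : ∀ j, ∑ k, Complex.normSq (W k j) = 1 := by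
    intro j
    have := congrArg Complex.re (congrFun (congrFun hW1 j) j)
    rw [mul_apply, Complex.re_sum, one_apply_eq, Complex.one_re] at this
    rw [← this]
    refine Finset.sum_congr rfl fun k _ => ?_
    rw [conjTranspose_apply, Complex.star_def, mul_comm, Complex.mul_conj, Complex.ofReal_re]
  calc vnEntropy A = ∑ j, (∑ k, Complex.normSq (W k j)) * Real.negMulLog (hA.1.eigenvalues j) := by
        rw [vn_eq hA.1]; simp [r2]
    _ = ∑ k, ∑ j, Complex.normSq (W k j) * Real.negMulLog (hA.1.eigenvalues j) := by
        simp_rw [Finset.sum_mul]; rw [Finset.sum_comm]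
    _ ≤ _ := by
        refine Finset.sum_le_sum fun k _ => ?_
        rw [ek]
        have := Real.concaveOn_negMulLog.le_map_sum (t := Finset.univ)
          (w := fun j => Complex.normSq (W k j)) (p := hA.1.eigenvalues)
          (fun j _ => Complex.normSq_nonneg _) (r1 k) (fun j _ => hA.eigenvalues_nonneg j)
        simpa using this

/-- Log-sum inequality. -/
lemma log_sum {κ : Type*} [Fintype κ] (x s : κ → ℝ) (hx : ∀ k, 0 ≤ x k) (hs : ∀ k, x k ≤ s k) :
    ∑ k, (Real.negMulLog (x k) + x k * Real.log (s k)) ≤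
      Real.negMulLog (∑ k, x k) + (∑ k, x k) * Real.log (∑ k, s k) := by
  set t := ∑ k, x k
  set S := ∑ k, s k
  have ht : 0 ≤ t := Finset.sum_nonneg fun k _ => hx k
  rcases ht.eq_or_lt with h | h
  · have hz : ∀ k, x k = 0 := fun k =>
      (Finset.sum_eq_zero_iff_of_nonneg fun k _ => hx k).1 h.symm k (Finset.mem_univ k)
    simp [hz, ← h]
  have hS : 0 < S := h.trans_le (Finset.sum_le_sum fun k _ => hs k)
  have key : ∀ k, Real.negMulLog (x k) + x k * Real.log (s k) ≤
      x k * (Real.log S - Real.log t) + (s k * (t / S) - x k) := by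
    intro k
    rcases (hx k).eq_or_lt with h0 | h0
    · rw [← h0]
      have : 0 ≤ s k * (t / S) := mul_nonneg ((hx k).trans (hs k)) (div_pos h hS).le
      simpa using this
    · have hsk := h0.trans_le (hs k)
      have h2 := Real.log_le_sub_one_of_pos (div_pos (mul_pos hsk h) (mul_pos h0 hS))
      rw [Real.log_div (mul_pos hsk h).ne' (mul_pos h0 hS).ne', Real.log_mul hsk.ne' h.ne',
        Real.log_mul h0.ne' hS.ne'] at h2
      have h3 := mul_le_mul_of_nonneg_left h2 h0.le
      have h4 : x k * (s k * t / (x k * S) - 1) = s k * (t / S) - x k := by field_simp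
      rw [h4] at h3
      rw [Real.negMulLog]
      linarith
  refine (Finset.sum_le_sum fun k _ => key k).trans ?_
  rw [Finset.sum_add_distrib, Finset.sum_sub_distrib, ← Finset.sum_mul, ← Finset.sum_mul,
    Real.negMulLog]
  change t * (Real.log S - Real.log t) + (S * (t / S) - t) ≤ -t * Real.log t + t * Real.log S
  have : S * (t / S) = t := by field_simp
  rw [this]; linarith

/-- Quantitative concavity. -/
lemma vn_concave {ι : Type*} [Fintype ι] (P : ι → Matrix n n ℂ) (hP : ∀ i, (P i).PosSemidef) :
    ∑ i, vnEntropy (P i) + Real.negMulLog (∑ i, (P i).trace.re) ≤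
      vnEntropy (∑ i, P i) + ∑ i, Real.negMulLog (P i).trace.re := by
  have hS : (∑ i, P i).PosSemidef := posSemidef_sum _ fun i _ => hP i
  obtain ⟨V, h1, h2, h3⟩ := spec hS.1
  set l := hS.1.eigenvalues
  let x : ι → n → ℝ := fun i k => ((Vᴴ * P i * V) k k).re
  have hx : ∀ i k, 0 ≤ x i k := fun i k =>
    (Complex.le_def.1 ((hP i).conjTranspose_mul_mul_same V).diag_nonneg).1
  have hsum : ∀ k, ∑ i, x i k = l k := by
    intro k
    simp only [x]
    rw [← Complex.re_sum, ← Matrix.sum_apply, ← Finset.sum_mul, ← Finset.mul_sum]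
    have : Vᴴ * (∑ i, P i) * V = diagonal (fun i => (l i : ℂ)) := by
      conv_lhs => rw [h3]
      rw [mul_assoc, mul_assoc, h1, mul_one, ← mul_assoc, h1, one_mul]
    rw [this]; simp
  have htr : ∀ i, ∑ k, x i k = (P i).trace.re := by
    intro i
    simp only [x]
    rw [← Complex.re_sum]
    change (trace (Vᴴ * P i * V)).re = _
    rw [mul_assoc, trace_mul_comm, mul_assoc, h2, mul_one]
  have hle : ∀ i k, x i k ≤ l k := fun i k => by
    rw [← hsum]; exact Finset.single_le_sum (fun j _ => hx j k) (Finset.mem_univ i)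
  have hT : ∑ k, l k = ∑ i, (P i).trace.re := by
    simp_rw [← hsum, ← htr]; rw [Finset.sum_comm]
  have hpe : ∀ i, vnEntropy (P i) ≤ ∑ k, Real.negMulLog (x i k) := fun i => peierls (hP i) h1 h2
  have hls := Finset.sum_le_sum fun i (_ : i ∈ Finset.univ) => log_sum (x i) l (hx i) (hle i)
  simp only [Finset.sum_add_distrib, ← Finset.sum_mul, htr, hT] at hls
  have e1 : ∑ i, ∑ k, x i k * Real.log (l k) = - vnEntropy (∑ i, P i) := by
    rw [Finset.sum_comm, vn_eq hS.1, ← Finset.sum_neg_distrib]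
    refine Finset.sum_congr rfl fun k _ => ?_
    rw [← Finset.sum_mul, hsum, Real.negMulLog]; ring
  have e2 := Finset.sum_le_sum fun i (_ : i ∈ Finset.univ) => hpe i
  rw [e1] at hls
  rw [Real.negMulLog]
  linarith

lemma vn_mono {ι : Type*} [Fintype ι] [DecidableEq ι] (A N : ι → Matrix n n ℂ)
    (hA : ∀ i, (A i).PosSemidef) (hN : ∀ i, (N i).PosSemidef) :
    vnEntropy (∑ i, (A i + N i)) + ∑ i, vnEntropy (A i) ≤
      vnEntropy (∑ i, A i) + ∑ i, vnEntropy (A i + N i) := by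
  have key : ∀ s : Finset ι, vnEntropy (∑ i, A i + ∑ i ∈ s, N i) + ∑ i ∈ s, vnEntropy (A i) ≤
      vnEntropy (∑ i, A i) + ∑ i ∈ s, vnEntropy (A i + N i) := by
    intro s
    induction s using Finset.induction_on with
    | empty => simp
    | insert j s hj ih =>
      rw [Finset.sum_insert hj, Finset.sum_insert hj, Finset.sum_insert hj]
      have hM : (∑ i ∈ Finset.univ.erase j, A i + ∑ i ∈ s, N i).PosSemidef :=
        (posSemidef_sum _ fun i _ => hA i).add (posSemidef_sum _ fun i _ => hN i)
      have h := vn_submod (hA j) hM (hN j)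
      rw [← add_assoc (A j), Finset.add_sum_erase _ _ (Finset.mem_univ j)] at h
      have : ∑ i, A i + (N j + ∑ i ∈ s, N i) = ∑ i, A i + ∑ i ∈ s, N i + N j := by abel
      rw [this]
      linarith
  have := key Finset.univ
  rwa [← Finset.sum_add_distrib] at this

lemma entropy_le_log {m : ℕ} (t : Fin m → ℝ) (ht : ∀ i, 0 ≤ t i) (hm : 0 < m) :
    ∑ i, Real.negMulLog (t i) ≤ Real.negMulLog (∑ i, t i) + (∑ i, t i) * Real.log m := by
  have hm' : (0 : ℝ) < m := by exact_mod_cast hm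
  have := Real.concaveOn_negMulLog.le_map_sum (t := Finset.univ)
    (w := fun _ : Fin m => (m : ℝ)⁻¹) (p := t) (fun _ _ => by positivity)
    (by simp [hm'.ne']) (fun i _ => ht i)
  simp only [smul_eq_mul, ← Finset.mul_sum] at this
  rw [Real.negMulLog_mul] at this
  have h2 := mul_le_mul_of_nonneg_left this hm'.le
  have e : Real.negMulLog ((m : ℝ)⁻¹) = (m : ℝ)⁻¹ * Real.log m := by
    rw [Real.negMulLog, Real.log_inv]; ring
  rw [e, mul_add, mul_inv_cancel_left₀ hm'.ne', mul_inv_cancel_left₀ hm'.ne'] at h2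
  have e2 : (m : ℝ) * ((∑ i, t i) * ((m : ℝ)⁻¹ * Real.log m)) = (∑ i, t i) * Real.log m := by
    field_simp
  rw [e2] at h2
  linarith

lemma one_sided {m : ℕ} (hm : 0 < m) (a b P N : Fin m → Matrix n n ℂ)
    (ha : ∀ i, (a i).PosSemidef) (hb : ∀ i, (b i).PosSemidef) (hP : ∀ i, (P i).PosSemidef)
    (hN : ∀ i, (N i).PosSemidef) (h : ∀ i, a i + N i = b i + P i)
    (ε : ℝ) (hPε : ∑ i, (P i).trace.re = ε) (hNε : ∑ i, (N i).trace.re = ε)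
    (htr : ∑ i, (b i).trace.re = 1) :
    (vnEntropy (∑ i, b i) - ∑ i, vnEntropy (b i)) - (vnEntropy (∑ i, a i) - ∑ i, vnEntropy (a i))
      ≤ ε * Real.log m + gFun ε := by
  have h1 := vn_mono a N ha hN
  simp only [h] at h1
  have hbS : (∑ i, b i).PosSemidef := posSemidef_sum _ fun i _ => hb i
  have hPS : (∑ i, P i).PosSemidef := posSemidef_sum _ fun i _ => hP i
  have h2 := vn_concave ![∑ i, b i, ∑ i, P i] (fun i => by fin_cases i <;> simpa)
  simp only [Fin.sum_univ_two, cons_val_zero, cons_val_one, trace_sum, Complex.re_sum, htr,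
    hPε, Real.negMulLog_one, zero_add] at h2
  have h3 := vn_concave P hP
  have h4 := entropy_le_log (fun i => (P i).trace.re)
    (fun i => (Complex.le_def.1 (hP i).trace_nonneg).1) hm
  simp only [hPε] at h3 h4
  have h5 : ∑ i, vnEntropy (b i + P i) ≤ ∑ i, vnEntropy (b i) + ∑ i, vnEntropy (P i) := by
    rw [← Finset.sum_add_distrib]
    refine Finset.sum_le_sum fun i _ => ?_
    have := vn_submod PosSemidef.zero (hb i) (hP i)
    simpa [vn_zero] using this
  rw [Finset.sum_add_distrib] at h1
  have h6 : gFun ε = Real.negMulLog ε - Real.negMulLog (1 + ε) := by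
    simp only [gFun, Real.negMulLog]; ring
  rw [h6]
  linarith

lemma jordan {A : Matrix n n ℂ} (hA : A.IsHermitian) (h0 : A.trace = 0) :
    ∃ P N : Matrix n n ℂ, P.PosSemidef ∧ N.PosSemidef ∧ A = P - N ∧
      P.trace.re = traceNorm A / 2 ∧ N.trace.re = traceNorm A / 2 := by
  obtain ⟨U, h1, h2, h3⟩ := spec hA
  set l := hA.eigenvalues with hl
  have htn : traceNorm A = ∑ i, |l i| := by
    rw [traceNorm]
    have e : Aᴴ * A = U * diagonal (fun i => ((l i ^ 2 : ℝ) : ℂ)) * Uᴴ := by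
      rw [hA.eq]
      conv_lhs => rw [h3]
      have : U * diagonal (fun i => (l i : ℂ)) * Uᴴ * (U * diagonal (fun i => (l i : ℂ)) * Uᴴ) =
        U * diagonal (fun i => (l i : ℂ)) * (Uᴴ * U) * diagonal (fun i => (l i : ℂ)) * Uᴴ := by
        simp only [mul_assoc]
      rw [this, h1, mul_one, mul_assoc U, diagonal_mul_diagonal]
      congr 3
      ext i
      push_cast; ring
    rw [eigsum _ h1 _ e]
    simp [Real.sqrt_sq_eq_abs]
  have htr : ∀ d : n → ℝ, (U * diagonal (fun i => (d i : ℂ)) * Uᴴ).trace.re = ∑ i, d i := by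
    intro d
    rw [trace_mul_comm, ← mul_assoc, h1, one_mul, trace_diagonal]
    simp
  have hsum : ∑ i, l i = 0 := by rw [hl, ← trace_re hA, h0]; simp
  refine ⟨U * diagonal (fun i => ((max (l i) 0 : ℝ) : ℂ)) * Uᴴ,
    U * diagonal (fun i => ((max (-l i) 0 : ℝ) : ℂ)) * Uᴴ,
    psd_diag fun i => le_max_right _ _, psd_diag fun i => le_max_right _ _, ?_, ?_, ?_⟩
  · conv_lhs => rw [h3]
    rw [← sub_mul, ← mul_sub, diagonal_sub]
    congr 3
    ext i
    rw [← Complex.ofReal_sub]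
    congr 1
    exact (max_zero_sub_max_neg_zero_eq_self (l i)).symm
  · rw [htr, htn]
    have : ∀ i, max (l i) 0 = (|l i| + l i) / 2 := fun i => by
      rcases le_total 0 (l i) with h | h
      · rw [max_eq_left h, abs_of_nonneg h]; ring
      · rw [max_eq_right h, abs_of_nonpos h]; ring
    simp only [this]
    rw [← Finset.sum_div, Finset.sum_add_distrib, hsum, add_zero]
  · rw [htr, htn]
    have : ∀ i, max (-l i) 0 = (|l i| - l i) / 2 := fun i => by
      rcases le_total 0 (l i) with h | h
      · rw [max_eq_right (by linarith), abs_of_nonneg h]; ring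
      · rw [max_eq_left (by linarith), abs_of_nonpos h]; ring
    simp only [this]
    rw [← Finset.sum_div, Finset.sum_sub_distrib, hsum, sub_zero]

end HolevoAux

theorem holevo_fannes_continuity_bound_equal_probs {n : Type*} [Fintype n] [DecidableEq n] (m : ℕ)
    (p : Fin m → ℝ) (hp : ∀ i, 0 ≤ p i) (hp1 : ∑ i, p i = 1)
    (ρ σ : Fin m → Matrix n n ℂ) (hρ : ∀ i, IsState (ρ i)) (hσ : ∀ i, IsState (σ i))
    (ε : ℝ) (hε : ε = (∑ i, p i * traceNorm (ρ i - σ i)) / 2) :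
    |holevo p ρ - holevo p σ| ≤ ε * Real.log m + gFun ε := by
  have hm : 0 < m := by
    rcases Nat.eq_zero_or_pos m with h | h
    · subst h; simp at hp1
    · exact h
  have hj := fun i => HolevoAux.jordan ((hρ i).1.1.sub (hσ i).1.1)
    (by rw [trace_sub, (hρ i).2, (hσ i).2, sub_self])
  choose P N hP hN hPN hPt hNt using hj
  have psm : ∀ i {A : Matrix n n ℂ}, A.PosSemidef → (p i • A).PosSemidef :=
    fun i A hA => hA.smul (hp i)
  have hs : ∀ τ : Fin m → Matrix n n ℂ, (∀ i, IsState (τ i)) → holevo p τ =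
      (vnEntropy (∑ i, p i • τ i) - ∑ i, vnEntropy (p i • τ i)) + ∑ i, Real.negMulLog (p i) := by
    intro τ hτ
    have : ∀ i, vnEntropy (p i • τ i) = p i * vnEntropy (τ i) + Real.negMulLog (p i) := fun i => by
      rw [HolevoAux.vn_smul (hτ i).1.1, (hτ i).2]; simp
    simp only [this, Finset.sum_add_distrib, holevo]; ring
  have ht1 : ∀ τ : Fin m → Matrix n n ℂ, (∀ i, IsState (τ i)) →
      ∑ i, (p i • τ i).trace.re = 1 := by
    intro τ hτ
    rw [← hp1]
    refine Finset.sum_congr rfl fun i _ => ?_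
    rw [trace_smul, (hτ i).2]; simp
  have hPs : ∑ i, (p i • P i).trace.re = ε := by
    rw [hε, Finset.sum_div]
    refine Finset.sum_congr rfl fun i _ => ?_
    rw [trace_smul, Complex.smul_re, hPt, smul_eq_mul]; ring
  have hNs : ∑ i, (p i • N i).trace.re = ε := by
    rw [hε, Finset.sum_div]
    refine Finset.sum_congr rfl fun i _ => ?_
    rw [trace_smul, Complex.smul_re, hNt, smul_eq_mul]; ring
  have he : ∀ i, p i • ρ i + p i • N i = p i • σ i + p i • P i := by
    intro i
    rw [← smul_add, ← smul_add]
    congr 1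
    have := hPN i
    rw [sub_eq_sub_iff_add_eq_add] at this
    rw [this, add_comm]
  rw [hs ρ hρ, hs σ hσ, abs_le]
  have k1 := HolevoAux.one_sided hm _ _ _ _ (fun i => psm i (hρ i).1) (fun i => psm i (hσ i).1)
    (fun i => psm i (hP i)) (fun i => psm i (hN i)) he ε hPs hNs (ht1 σ hσ)
  have k2 := HolevoAux.one_sided hm _ _ _ _ (fun i => psm i (hσ i).1) (fun i => psm i (hρ i).1)
    (fun i => psm i (hN i)) (fun i => psm i (hP i)) (fun i => (he i).symm) ε hNs hPs (ht1 ρ hρ)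
  constructor <;> linarith
end
end
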